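/- There exist points X, Y in Baire space ℕ^ℕ such that {X} and {Y} are Π⁰₁ subsets of ℕ^ℕ (i.e., X and Y are Π⁰₁ singletons) and X, Y are arithmetically incomparable: X is not arithmetical relative to Y and Y is not arithmetical relative to X. -/

import Mathlib

namespace Harrington

open scoped Classical

/-- Codes for oracle Turing machines (partial recursive functionals),
    extending `Nat.Partrec.Code` with an `oracle` constructor. -/
inductive OCode : Type
  | zero : OCode
  | succ : OCode
  | left : OCode
  | right : OCode
  | oracle : OCode
  | pair : OCode → OCode → OCode
  | comp : OCode → OCode → OCode
  | prec : OCode → OCode → OCode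
  | rfind' : OCode → OCode

/-- Evaluation of an oracle code relative to a (total) oracle `A`. -/
def evalo (A : ℕ → ℕ) : OCode → ℕ →. ℕ
  | OCode.zero => pure 0
  | OCode.succ => fun n => Part.some (n + 1)
  | OCode.left => fun n => Part.some (Nat.unpair n).1
  | OCode.right => fun n => Part.some (Nat.unpair n).2
  | OCode.oracle => fun n => Part.some (A n)
  | OCode.pair cf cg => fun n => Nat.pair <$> evalo A cf n <*> evalo A cg n
  | OCode.comp cf cg => fun n => evalo A cg n >>= evalo A cf
  | OCode.prec cf cg =>
    Nat.unpaired fun a n =>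
      n.rec (evalo A cf a) fun y IH => do
        let i ← IH
        evalo A cg (Nat.pair a (Nat.pair y i))
  | OCode.rfind' cf =>
    Nat.unpaired fun a m =>
      (Nat.rfind fun n => (fun x => x = 0) <$> evalo A cf (Nat.pair a (n + m))).map (· + m)

/-- The standard enumeration of oracle codes: `OCode.ofNat e` is the `e`-th oracle machine. -/
def OCode.ofNat : ℕ → OCode
  | 0 => OCode.zero
  | 1 => OCode.succ
  | 2 => OCode.left
  | 3 => OCode.right
  | 4 => OCode.oracle
  | n + 5 =>
    have hm : n.div2.div2 < n + 5 := by
      have h1 : n.div2.div2 ≤ n := by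
        simp only [Nat.div2_val]
        exact le_trans (Nat.div_le_self _ _) (Nat.div_le_self _ _)
      omega
    have _m1 : n.div2.div2.unpair.1 < n + 5 := lt_of_le_of_lt (Nat.unpair_left_le _) hm
    have _m2 : n.div2.div2.unpair.2 < n + 5 := lt_of_le_of_lt (Nat.unpair_right_le _) hm
    match n.bodd, n.div2.bodd with
    | false, false => OCode.pair (OCode.ofNat n.div2.div2.unpair.1) (OCode.ofNat n.div2.div2.unpair.2)
    | false, true  => OCode.comp (OCode.ofNat n.div2.div2.unpair.1) (OCode.ofNat n.div2.div2.unpair.2)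
    | true,  false => OCode.prec (OCode.ofNat n.div2.div2.unpair.1) (OCode.ofNat n.div2.div2.unpair.2)
    | true,  true  => OCode.rfind' (OCode.ofNat n.div2.div2)

/-- The Turing jump `A'` of an oracle `A`:  `A'(e) = 1` if the `e`-th machine with
    oracle `A` halts on input `e`, and `A'(e) = 0` otherwise. -/
noncomputable def jump (A : ℕ → ℕ) : ℕ → ℕ :=
  fun e => if (evalo A (OCode.ofNat e) e).Dom then 1 else 0

/-- Iterated Turing jump `A^{(n)}`. -/
noncomputable def jumpIter (A : ℕ → ℕ) : ℕ → (ℕ → ℕ)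
  | 0 => A
  | n + 1 => jump (jumpIter A n)

/-- The constant zero function (the trivial oracle `0`). -/
def zeroF : ℕ → ℕ := fun _ => 0

/-- The `ω`-jump: `X^{(ω)} = {(i,n) : i ∈ X^{(n)}}`, coded via `Nat.pair` and identified
    with its characteristic function. -/
noncomputable def omegaJump (A : ℕ → ℕ) : ℕ → ℕ :=
  fun m => if jumpIter A m.unpair.2 m.unpair.1 ≠ 0 then 1 else 0

/-- The recursive join `A ⊕ B`. -/
def oplus (A B : ℕ → ℕ) : ℕ → ℕ :=
  fun n => if n % 2 = 0 then A (n / 2) else B (n / 2)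

/-- Code `c` computes the total function `f` from oracle `A`. -/
def computesFn (A : ℕ → ℕ) (c : OCode) (f : ℕ → ℕ) : Prop :=
  ∀ n, evalo A c n = Part.some (f n)

/-- Turing reducibility `X ≤_T A` for points of Baire space. -/
def TRedIn (X A : ℕ → ℕ) : Prop := ∃ c : OCode, computesFn A c X

/-- `X` is arithmetical relative to `Y`: `X ≤_T Y^{(n)}` for some `n`. -/
def ArithIn (X Y : ℕ → ℕ) : Prop := ∃ n : ℕ, TRedIn X (jumpIter Y n)

/-- `X` and `Y` are arithmetically equivalent. -/
def ArithEquiv (X Y : ℕ → ℕ) : Prop := ArithIn X Y ∧ ArithIn Y X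

/-! ### Strings and trees -/

/-- Strings: finite sequences of natural numbers. -/
abbrev Str := List ℕ

/-- The initial segment `X↾n` of a point `X` of Baire space. -/
def initSeg (X : ℕ → ℕ) (n : ℕ) : Str := (List.range n).map X

/-- A tree is a set of strings closed under initial segments. -/
def IsTree (T : Set Str) : Prop := ∀ σ τ : Str, σ <+: τ → τ ∈ T → σ ∈ T

/-- `[T]`, the set of paths through `T`. -/
def paths (T : Set Str) : Set (ℕ → ℕ) := {X | ∀ n, initSeg X n ∈ T}

/-- The characteristic function of a set of strings. -/
noncomputable def chi (T : Set Str) : Str → ℕ := fun σ => if σ ∈ T then 1 else 0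

/-- A set of strings is `A`-recursive: its characteristic function is computable from `A`. -/
def SetRecIn (A : ℕ → ℕ) (T : Set Str) : Prop :=
  ∃ c : OCode, ∀ σ : Str, evalo A c (Encodable.encode σ) = Part.some (chi T σ)

/-- `P ⊆ ℕ^ℕ` is `Π^{0,A}_1` : `P = [T]` for some `A`-recursive tree `T`. -/
def IsPi01In (A : ℕ → ℕ) (P : Set (ℕ → ℕ)) : Prop :=
  ∃ T : Set Str, IsTree T ∧ SetRecIn A T ∧ P = paths T

/-- `P ⊆ ℕ^ℕ` is `Π⁰₁` : `P = [T]` for some recursive tree `T`. -/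
def IsPi01 (P : Set (ℕ → ℕ)) : Prop := IsPi01In zeroF P

/-! ### Treemaps -/

/-- `F` is a treemap on the tree `T`: `F(σ⌢⟨i⟩) ⊇ F(σ)⌢⟨i⟩` whenever `σ⌢⟨i⟩ ∈ T`. -/
def IsTreemapOn (T : Set Str) (F : Str → Str) : Prop :=
  ∀ (σ : Str) (i : ℕ), σ ++ [i] ∈ T → (F σ) ++ [i] <+: F (σ ++ [i])

/-- The image tree `F(T) = {τ : ∃ σ ∈ T, τ ⊆ F(σ)}`. -/
def treeImage (F : Str → Str) (T : Set Str) : Set Str :=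
  {τ | ∃ σ ∈ T, τ <+: F σ}

/-- The map on paths induced by a treemap: `X ↦ ⋃ₙ F(X↾n)`. -/
def pathMap (F : Str → Str) (X : ℕ → ℕ) : ℕ → ℕ :=
  fun i => (F (initSeg X (i + 1))).getD i 0

/-- The string function `F` is `A`-recursive on `T` (restriction of a partial
    `A`-recursive function). -/
def FnRecInOn (A : ℕ → ℕ) (F : Str → Str) (T : Set Str) : Prop :=
  ∃ c : OCode, ∀ σ ∈ T, evalo A c (Encodable.encode σ) = Part.some (Encodable.encode (F σ))

/-- `F` maps `P` homeomorphically onto `Q` (subspace topologies from Baire space). -/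
def HomeoOn (F : (ℕ → ℕ) → (ℕ → ℕ)) (P Q : Set (ℕ → ℕ)) : Prop :=
  Set.BijOn F P Q ∧ ContinuousOn F P ∧
    ∃ G : (ℕ → ℕ) → (ℕ → ℕ), Set.InvOn G F P Q ∧ ContinuousOn G Q

/-- `f X ≡_T g X` uniformly for all `X ∈ P`: the Turing reductions are given by
    fixed indices independent of `X`. -/
def UnifEquivOn (P : Set (ℕ → ℕ)) (f g : (ℕ → ℕ) → (ℕ → ℕ)) : Prop :=
  ∃ c d : OCode, ∀ X ∈ P, computesFn (g X) c (f X) ∧ computesFn (f X) d (g X)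

/-! ### Standard enumerations -/

/-- `W_e^A`: the `e`-th `A`-recursively enumerable set of strings. -/
def WA (A : ℕ → ℕ) (e : ℕ) : Set Str :=
  {σ | (evalo A (OCode.ofNat e) (Encodable.encode σ)).Dom}

/-- `T_e^A = {σ : ∀ n ≤ |σ|, σ↾n ∉ W_e^A}`: the standard enumeration of `Π^{0,A}_1` trees. -/
def TA (A : ℕ → ℕ) (e : ℕ) : Set Str :=
  {σ | ∀ n ≤ σ.length, σ.take n ∉ WA A e}

/-- `P_e^A = [T_e^A]`: the standard enumeration of `Π^{0,A}_1` subsets of Baire space. -/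
def PA (A : ℕ → ℕ) (e : ℕ) : Set (ℕ → ℕ) := paths (TA A e)

/-! ### The arithmetical hierarchy on Baire space -/

/-- Prepend a number to a point of Baire space. -/
def consF (k : ℕ) (X : ℕ → ℕ) : ℕ → ℕ := fun i => Nat.casesOn i k fun j => X j

/-- `Σ⁰ₙ` subsets of Baire space.  `Σ⁰₀` sets are the recursive clopen sets
    (depending computably on a fixed finite initial segment), and
    `Σ⁰ₙ₊₁` sets are obtained from `Π⁰ₙ` sets by existential number quantification. -/
def SigmaN : ℕ → Set (ℕ → ℕ) → Prop
  | 0, P => ∃ (k : ℕ) (f : Str → Bool), Computable f ∧ P = {X | f (initSeg X k) = true}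
  | n + 1, P => ∃ Q : Set (ℕ → ℕ), SigmaN n Qᶜ ∧ P = {X | ∃ k : ℕ, consF k X ∈ Q}

/-- `Π⁰ₙ` subsets of Baire space: complements of `Σ⁰ₙ` sets. -/
def PiN (n : ℕ) (P : Set (ℕ → ℕ)) : Prop := SigmaN n Pᶜ

/-- Arithmetical subsets of Baire space: `Π⁰ₙ` for some `n`. -/
def IsArith (P : Set (ℕ → ℕ)) : Prop := ∃ n : ℕ, PiN n P

section HarringtonConstruction

open Nat.Partrec Encodable

attribute [fun_prop] Primrec PrimrecPred Primrec.id Primrec.const Primrec.comp Primrec.pair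

section PrimrecAutomation

variable {α β γ δ : Type*} [Primcodable α] [Primcodable β] [Primcodable γ] [Primcodable δ]

@[fun_prop] theorem primrec_fst {f : α → β × γ} (h : Primrec f) : Primrec fun a => (f a).1 :=
  Primrec.fst.comp h

@[fun_prop] theorem primrec_snd {f : α → β × γ} (h : Primrec f) : Primrec fun a => (f a).2 :=
  Primrec.snd.comp h

@[fun_prop] theorem primrec_add {f g : α → ℕ} (hf : Primrec f) (hg : Primrec g) :
    Primrec fun a => f a + g a := Primrec.nat_add.comp hf hg

@[fun_prop] theorem primrec_sub {f g : α → ℕ} (hf : Primrec f) (hg : Primrec g) :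
    Primrec fun a => f a - g a := Primrec.nat_sub.comp hf hg

@[fun_prop] theorem primrec_mul {f g : α → ℕ} (hf : Primrec f) (hg : Primrec g) :
    Primrec fun a => f a * g a := Primrec.nat_mul.comp hf hg

@[fun_prop] theorem primrec_div {f g : α → ℕ} (hf : Primrec f) (hg : Primrec g) :
    Primrec fun a => f a / g a := Primrec.nat_div.comp hf hg

@[fun_prop] theorem primrec_mod {f g : α → ℕ} (hf : Primrec f) (hg : Primrec g) :
    Primrec fun a => f a % g a := Primrec.nat_mod.comp hf hg

@[fun_prop] theorem primrec_div2 {f : α → ℕ} (hf : Primrec f) :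
    Primrec fun a => (f a).div2 := Primrec.nat_div2.comp hf

@[fun_prop] theorem primrec_bodd {f : α → ℕ} (hf : Primrec f) :
    Primrec fun a => (f a).bodd := Primrec.nat_bodd.comp hf

@[fun_prop] theorem primrec_natPair {f g : α → ℕ} (hf : Primrec f) (hg : Primrec g) :
    Primrec fun a => Nat.pair (f a) (g a) := Primrec₂.natPair.comp hf hg

@[fun_prop] theorem primrec_unpair {f : α → ℕ} (hf : Primrec f) :
    Primrec fun a => (f a).unpair := Primrec.unpair.comp hf

@[fun_prop] theorem primrec_encode {f : α → β} (h : Primrec f) :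
    Primrec fun a => encode (f a) := Primrec.encode.comp h

@[fun_prop] theorem primrec_take {f : α → ℕ} {g : α → List β} (hf : Primrec f) (hg : Primrec g) :
    Primrec fun a => List.take (f a) (g a) := Primrec.list_take.comp hf hg

@[fun_prop] theorem primrec_tail {g : α → List β} (hg : Primrec g) :
    Primrec fun a => (g a).tail := Primrec.list_tail.comp hg

@[fun_prop] theorem primrec_append {f g : α → List β} (hf : Primrec f) (hg : Primrec g) :
    Primrec fun a => f a ++ g a := Primrec.list_append.comp hf hg

@[fun_prop] theorem primrec_cons {f : α → β} {g : α → List β} (hf : Primrec f) (hg : Primrec g) :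
    Primrec fun a => f a :: g a := Primrec.list_cons.comp hf hg

@[fun_prop] theorem primrec_length {g : α → List β} (hg : Primrec g) :
    Primrec fun a => (g a).length := Primrec.list_length.comp hg

@[fun_prop] theorem primrec_getD {g : α → List β} {f : α → ℕ} {d : β} (hg : Primrec g)
    (hf : Primrec f) : Primrec fun a => (g a).getD (f a) d := (Primrec.list_getD d).comp hg hf

@[fun_prop] theorem primrec_range {f : α → ℕ} (hf : Primrec f) :
    Primrec fun a => List.range (f a) := Primrec.list_range.comp hf

@[fun_prop] theorem primrec_map {f : α → List β} {g : α → β → γ} (hf : Primrec f)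
    (hg : Primrec fun p : α × β => g p.1 p.2) : Primrec fun a => (f a).map (g a) :=
  Primrec.list_map hf hg

@[fun_prop] theorem primrecPred_and {p q : α → Prop} (hp : PrimrecPred p) (hq : PrimrecPred q) :
    PrimrecPred fun a => p a ∧ q a := hp.and hq

@[fun_prop] theorem primrecPred_or {p q : α → Prop} (hp : PrimrecPred p) (hq : PrimrecPred q) :
    PrimrecPred fun a => p a ∨ q a := hp.or hq

@[fun_prop] theorem primrecPred_not {p : α → Prop} (hp : PrimrecPred p) :
    PrimrecPred fun a => ¬ p a := hp.not

@[fun_prop] theorem primrecPred_le {f g : α → ℕ} (hf : Primrec f) (hg : Primrec g) :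
    PrimrecPred fun a => f a ≤ g a := Primrec.nat_le.comp hf hg

@[fun_prop] theorem primrecPred_lt {f g : α → ℕ} (hf : Primrec f) (hg : Primrec g) :
    PrimrecPred fun a => f a < g a := Primrec.nat_lt.comp hf hg

@[fun_prop] theorem primrecPred_eq {f g : α → β} (hf : Primrec f) (hg : Primrec g) :
    PrimrecPred fun a => f a = g a := Primrec.eq.comp hf hg

@[fun_prop] theorem primrecPred_comp {p : β → Prop} {f : α → β} (hp : PrimrecPred p)
    (hf : Primrec f) : PrimrecPred fun a => p (f a) := hp.comp hf

@[fun_prop] theorem primrecPred_exists_lt {f : α → ℕ} {p : α → ℕ → Prop} (hf : Primrec f)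
    (hp : PrimrecPred fun q : α × ℕ => p q.1 q.2) : PrimrecPred fun a => ∃ x < f a, p a x :=
  ((PrimrecRel.exists_mem_list (R := fun (x : ℕ) (a : α) => p a x)
    (hp.comp (Primrec.snd.pair Primrec.fst))).comp (primrec_range hf) Primrec.id).of_eq
    fun a => by simp

@[fun_prop] theorem primrecPred_forall_lt {f : α → ℕ} {p : α → ℕ → Prop} (hf : Primrec f)
    (hp : PrimrecPred fun q : α × ℕ => p q.1 q.2) : PrimrecPred fun a => ∀ x < f a, p a x :=
  ((PrimrecRel.forall_mem_list (R := fun (x : ℕ) (a : α) => p a x)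
    (hp.comp (Primrec.snd.pair Primrec.fst))).comp (primrec_range hf) Primrec.id).of_eq
    fun a => by simp

@[fun_prop] theorem primrec_ite {p : α → Prop} [DecidablePred p] {f g : α → β} (hp : PrimrecPred p)
    (hf : Primrec f) (hg : Primrec g) : Primrec fun a => if p a then f a else g a := 
  Primrec.ite hp hf hg

@[fun_prop] theorem primrec_ofNat_code {f : α → ℕ} (hf : Primrec f) :
    Primrec fun a => Denumerable.ofNat Code (f a) := (Primrec.ofNat Code).comp hf

@[fun_prop] theorem primrec_ofNat_tuple {f : α → ℕ} (hf : Primrec f) :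
    Primrec fun a => Denumerable.ofNat (ℕ × ℕ × List ℕ) (f a) :=
  (Primrec.ofNat (ℕ × ℕ × List ℕ)).comp hf

@[fun_prop] theorem primrec_ofNat_strNat {f : α → ℕ} (hf : Primrec f) :
    Primrec fun a => Denumerable.ofNat (List ℕ × ℕ) (f a) :=
  (Primrec.ofNat (List ℕ × ℕ)).comp hf

@[fun_prop] theorem primrec_evaln {k n : α → ℕ} {c : α → Code} (hk : Primrec k) (hc : Primrec c)
    (hn : Primrec n) : Primrec fun a => Code.evaln (k a) (c a) (n a) :=
  Code.primrec_evaln.comp ((hk.pair hc).pair hn)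

@[fun_prop] theorem primrecPred_isPrefix_rel [DecidableEq β] {f g : α → List β} (hf : Primrec f)
    (hg : Primrec g) : PrimrecPred fun a => f a <+: g a := by
  have : PrimrecPred fun a => f a = (g a).take (f a).length := by fun_prop
  exact this.of_eq fun a => List.prefix_iff_eq_take.symm

end PrimrecAutomation

section InitSeg

@[simp] theorem length_initSeg (X : ℕ → ℕ) (n : ℕ) : (initSeg X n).length = n := by
  simp [initSeg]

theorem getElem?_initSeg (X : ℕ → ℕ) (n i : ℕ) :
    (initSeg X n)[i]? = if i < n then some (X i) else none := by
  by_cases h : i < n <;> simp [initSeg, h]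

@[simp] theorem getElem_initSeg (X : ℕ → ℕ) (n i : ℕ) (h : i < (initSeg X n).length) :
    (initSeg X n)[i] = X i := by simp [initSeg]

theorem getD_initSeg {X : ℕ → ℕ} {n i : ℕ} (h : i < n) (d : ℕ) : (initSeg X n).getD i d = X i := by
  simp [List.getD, h]

@[simp] theorem take_initSeg (X : ℕ → ℕ) (m n : ℕ) :
    (initSeg X n).take m = initSeg X (min m n) := by
  apply List.ext_getElem? ; intro i
  rw [List.getElem?_take, getElem?_initSeg, getElem?_initSeg]
  grind

theorem initSeg_succ (X : ℕ → ℕ) (n : ℕ) : initSeg X (n + 1) = initSeg X n ++ [X n] := by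
  simp [initSeg, List.range_succ]

@[simp] theorem initSeg_zero (X : ℕ → ℕ) : initSeg X 0 = [] := rfl

theorem initSeg_mono (X : ℕ → ℕ) {m n : ℕ} (h : m ≤ n) : initSeg X m <+: initSeg X n := by
  rw [List.prefix_iff_eq_take]; simp [h]

theorem initSeg_congr {X Y : ℕ → ℕ} {n : ℕ} (h : ∀ i < n, X i = Y i) :
    initSeg X n = initSeg Y n := by
  simp only [initSeg]; exact List.map_congr_left fun i hi => h i (List.mem_range.1 hi)

theorem initSeg_inj {X Y : ℕ → ℕ} {n : ℕ} (h : initSeg X n = initSeg Y n) {i : ℕ} (hi : i < n) :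
    X i = Y i := by
  have := congrArg (fun l => l.getD i 0) h
  rwa [getD_initSeg hi, getD_initSeg hi] at this

theorem eq_initSeg_iff {X : ℕ → ℕ} {σ : Str} :
    σ = initSeg X σ.length ↔ ∀ i < σ.length, X i = σ.getD i 0 := by
  constructor
  · intro h i hi
    conv_rhs => rw [h]
    rw [getD_initSeg hi]
  · intro h
    apply List.ext_getElem
    · simp
    · intro i h1 h2
      simp [h i h1, h1]

end InitSeg

section Semidecidable

variable {α β : Type*} [Primcodable α] [Primcodable β]

/-- Machine `e` on input `x` accepts within stage `k`, consulting the two oracle strings `σ`, `τ`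
only through bounded initial segments. -/
def st (σ τ : Str) (e x k : ℕ) : Prop :=
  Code.evaln k.unpair.2 (Denumerable.ofNat Code e)
    (encode ((σ.take k.unpair.1, τ.take k.unpair.1), (x, k.unpair.1))) = some 1

@[fun_prop] theorem primrecPred_st {σ τ : α → Str} {e x k : α → ℕ} (hσ : Primrec σ)
    (hτ : Primrec τ) (he : Primrec e) (hx : Primrec x) (hk : Primrec k) :
    PrimrecPred fun a => st (σ a) (τ a) (e a) (x a) (k a) := by
  unfold st; fun_prop

theorem st_take {σ τ : Str} {e x k m n : ℕ} (hm : k ≤ m) (hn : k ≤ n) :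
    st (σ.take m) (τ.take n) e x k ↔ st σ τ e x k := by
  have := Nat.unpair_left_le k
  simp only [st, List.take_take, min_eq_left (this.trans hm), min_eq_left (this.trans hn)]

/-- The set semidecided by machine `e` from the oracle pair `A`, `X`. -/
def W (A X : ℕ → ℕ) (e x : ℕ) : Prop := ∃ k, st (initSeg A k) (initSeg X k) e x k

theorem st_initSeg {A X : ℕ → ℕ} {e x k m n : ℕ} (hm : k ≤ m) (hn : k ≤ n) :
    st (initSeg A m) (initSeg X n) e x k ↔ st (initSeg A k) (initSeg X k) e x k := by
  rw [← st_take le_rfl le_rfl]; simp [hm, hn]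

/-- Uniform semidecidability relative to a pair of oracles. -/
def S1 {ι : Type*} (O P : ι → ℕ → ℕ) (Φ : ι → α → Prop) : Prop :=
  ∃ p : (Str × Str) × (α × ℕ) → Prop, PrimrecPred p ∧
    ∀ i a, Φ i a ↔ ∃ t, p ((initSeg (O i) t, initSeg (P i) t), (a, t))

variable {ι κ : Type*} {O P : ι → ℕ → ℕ}

theorem S1.of_iff {Φ Ψ : ι → α → Prop} (h : S1 O P Φ) (H : ∀ i a, Ψ i a ↔ Φ i a) : S1 O P Ψ := by
  obtain ⟨p, hp, h⟩ := h
  exact ⟨p, hp, fun i a => (H i a).trans (h i a)⟩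

theorem S1.base {g : α → ℕ} (hg : Primrec g) {p : (Str × Str) × α → Prop} (hp : PrimrecPred p) :
    S1 O P fun i a => p ((initSeg (O i) (g a), initSeg (P i) (g a)), a) := by
  refine ⟨fun q => g q.2.1 ≤ q.2.2 ∧ p ((q.1.1.take (g q.2.1), q.1.2.take (g q.2.1)), q.2.1),
    by fun_prop, fun i a => ⟨fun h => ⟨g a, by simpa using h⟩, ?_⟩⟩
  rintro ⟨t, h1, h2⟩
  simpa [h1] using h2

theorem S1.prim {p : α → Prop} (hp : PrimrecPred p) : S1 O P fun _ a => p a :=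
  S1.base (g := fun _ => 0) (by fun_prop) (p := fun q => p q.2) (by fun_prop)

theorem S1.comp {Φ : ι → α → Prop} (h : S1 O P Φ) {g : β → α} (hg : Primrec g) :
    S1 O P fun i b => Φ i (g b) := by
  obtain ⟨p, hp, h⟩ := h
  exact ⟨fun q => p (q.1, (g q.2.1, q.2.2)), by fun_prop, fun i a => h i _⟩

theorem S1.and {Φ Ψ : ι → α → Prop} (h : S1 O P Φ) (h' : S1 O P Ψ) :
    S1 O P fun i a => Φ i a ∧ Ψ i a := by
  obtain ⟨p, hp, h⟩ := h
  obtain ⟨q, hq, h'⟩ := h'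
  refine ⟨fun r => ∃ u < r.2.2, ∃ v < r.2.2,
    p ((r.1.1.take u, r.1.2.take u), (r.2.1, u)) ∧ q ((r.1.1.take v, r.1.2.take v), (r.2.1, v)),
    by fun_prop, fun i a => ?_⟩
  refine (and_congr (h i a) (h' i a)).trans ?_
  constructor
  · rintro ⟨⟨u, hu⟩, v, hv⟩
    exact ⟨u + v + 1, u, by dsimp only; omega, v, by dsimp only; omega, by
      simpa [min_eq_left (show u ≤ u + v + 1 by omega)] using hu, by
      simpa [min_eq_left (show v ≤ u + v + 1 by omega)] using hv⟩
  · rintro ⟨t, u, hu, v, hv, h1, h2⟩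
    simp only at hu hv
    simp only [take_initSeg, min_eq_left hu.le, min_eq_left hv.le] at h1 h2
    exact ⟨⟨u, h1⟩, v, h2⟩

theorem S1.ex {Φ : ι → α → β → Prop} (h : S1 O P fun i (q : α × β) => Φ i q.1 q.2) :
    S1 O P fun i a => ∃ b, Φ i a b := by
  obtain ⟨p, hp, h⟩ := h
  obtain ⟨_, hp⟩ := hp
  refine ⟨fun r => ((decode (α := β) r.2.2.unpair.1).casesOn false fun b =>
    decide (p ((r.1.1.take r.2.2.unpair.2, r.1.2.take r.2.2.unpair.2),
      ((r.2.1, b), r.2.2.unpair.2)))) = true, ⟨inferInstance, ?_⟩, fun i a => ?_⟩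
  · simp only [Bool.decide_eq_true]
    refine Primrec.option_casesOn (Primrec.decode.comp (by fun_prop)) (Primrec.const _) ?_
    exact hp.comp (f := fun p => decide _) (g := fun r : ((Str × Str) × (α × ℕ)) × β =>
      ((r.1.1.1.take r.1.2.2.unpair.2, r.1.1.2.take r.1.2.2.unpair.2),
      ((r.1.2.1, r.2), r.1.2.2.unpair.2))) (by fun_prop)
  · constructor
    · rintro ⟨b, hb⟩
      obtain ⟨t, ht⟩ := (h i (a, b)).1 hb
      refine ⟨Nat.pair (encode b) t, ?_⟩
      simpa [min_eq_left (Nat.right_le_pair (encode b) t)] using ht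
    · rintro ⟨t, ht⟩
      cases hd : decode (α := β) t.unpair.1 with
      | none => simp [hd] at ht
      | some b =>
        refine ⟨b, (h i (a, b)).2 ⟨t.unpair.2, ?_⟩⟩
        simpa [hd, min_eq_left (Nat.unpair_right_le t)] using ht

theorem S1.or {Φ Ψ : ι → α → Prop} (h : S1 O P Φ) (h' : S1 O P Ψ) :
    S1 O P fun i a => Φ i a ∨ Ψ i a := by
  obtain ⟨p, hp, h⟩ := h
  obtain ⟨q, hq, h'⟩ := h'
  refine ⟨fun r => p r ∨ q r, by fun_prop, fun i a => ?_⟩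
  exact (or_congr (h i a) (h' i a)).trans exists_or.symm

theorem S1.ball {Φ : ι → α → ℕ → Prop} (h : S1 O P fun i (q : α × ℕ) => Φ i q.1 q.2)
    {g : α → ℕ} (hg : Primrec g) : S1 O P fun i a => ∀ x < g a, Φ i a x := by
  obtain ⟨p, hp, h⟩ := h
  refine ⟨fun r => ∀ x < g r.2.1, ∃ u < r.2.2,
    p ((r.1.1.take u, r.1.2.take u), ((r.2.1, x), u)), by fun_prop, fun i a => ?_⟩
  constructor
  · intro H
    have : ∀ n ≤ g a, ∃ t, ∀ x < n, ∃ u < t,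
        p ((initSeg (O i) u, initSeg (P i) u), ((a, x), u)) := by
      intro n
      induction n with
      | zero => intro _; exact ⟨0, by simp⟩
      | succ n ih =>
        intro hn
        obtain ⟨t, ht⟩ := ih (by omega)
        obtain ⟨u, hu⟩ := (h i (a, n)).1 (H n (by omega))
        refine ⟨t + u + 1, fun x hx => ?_⟩
        rcases Nat.lt_succ_iff_lt_or_eq.1 hx with hx | rfl
        · obtain ⟨v, hv, hv'⟩ := ht x hx
          exact ⟨v, by omega, hv'⟩
        · exact ⟨u, by omega, hu⟩
    obtain ⟨t, ht⟩ := this _ le_rfl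
    refine ⟨t, fun x hx => ?_⟩
    obtain ⟨u, hu, hu'⟩ := ht x hx
    refine ⟨u, hu, by simpa [min_eq_left hu.le] using hu'⟩
  · rintro ⟨t, ht⟩ x hx
    obtain ⟨u, hu, hu'⟩ := ht x hx
    simp only at hu
    refine (h i (a, x)).2 ⟨u, by simpa [min_eq_left hu.le] using hu'⟩

theorem S1.bex {Φ : ι → α → ℕ → Prop} (h : S1 O P fun i (q : α × ℕ) => Φ i q.1 q.2)
    {g : α → ℕ} (hg : Primrec g) : S1 O P fun i a => ∃ x < g a, Φ i a x :=
  S1.ex ((S1.prim (p := fun q : α × ℕ => q.2 < g q.1) (by fun_prop)).and h)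

theorem S1.query_left {f g : α → ℕ} (hf : Primrec f) (hg : Primrec g) :
    S1 O P fun i a => O i (f a) = g a := by
  refine (S1.base (g := fun a => f a + 1) (by fun_prop)
    (p := fun q => q.1.1.getD (f q.2) 0 = g q.2) (by fun_prop)).of_iff fun i a => ?_
  simp only; rw [getD_initSeg (by omega)]

theorem S1.query_right {f g : α → ℕ} (hf : Primrec f) (hg : Primrec g) :
    S1 O P fun i a => P i (f a) = g a := by
  refine (S1.base (g := fun a => f a + 1) (by fun_prop)
    (p := fun q => q.1.2.getD (f q.2) 0 = g q.2) (by fun_prop)).of_iff fun i a => ?_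
  simp only; rw [getD_initSeg (by omega)]

theorem S1.univ {e x : α → ℕ} (he : Primrec e) (hx : Primrec x) :
    S1 O P fun i a => W (O i) (P i) (e a) (x a) :=
  ⟨fun q => st q.1.1 q.1.2 (e q.2.1) (x q.2.1) q.2.2, by fun_prop, fun _ _ => Iff.rfl⟩

theorem S1.extend {Φ : ι → α → Prop} (h : S1 O P Φ) :
    ∃ Ψ : (ℕ → ℕ) × (ℕ → ℕ) → α → Prop, S1 Prod.fst Prod.snd Ψ ∧
      ∀ i a, Φ i a ↔ Ψ (O i, P i) a := by
  obtain ⟨p, hp, h⟩ := h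
  exact ⟨_, ⟨p, hp, fun _ _ => Iff.rfl⟩, h⟩

theorem S1.fix_nat {Θ : ι → ℕ → ℕ → Prop}
    (h : S1 O P fun i (q : ℕ × ℕ) => Θ i q.1 q.2) :
    ∃ c, ∀ i x, W (O i) (P i) c x ↔ Θ i c x := by
  obtain ⟨p, hp, h⟩ := h
  let D : ℕ → (Str × Str) × (ℕ × ℕ) := Denumerable.ofNat _
  have hD : Primrec D := Primrec.ofNat _
  let f : Code × ℕ → ℕ := fun q =>
    if p ((D q.2).1, ((encode q.1, (D q.2).2.1), (D q.2).2.2)) then 1 else 0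
  have hf : Primrec f := by fun_prop
  obtain ⟨c, hc⟩ := Code.fixed_point₂ (f := fun c n => Part.some (f (c, n))) hf.to_comp
  refine ⟨encode c, fun i x => ?_⟩
  refine Iff.trans ?_ (h i (encode c, x)).symm
  have key : ∀ k, f (c, encode ((initSeg (O i) k, initSeg (P i) k), (x, k))) = 1 ↔
      p ((initSeg (O i) k, initSeg (P i) k), ((encode c, x), k)) := by
    intro k
    simp only [f, D, Denumerable.ofNat_encode]
    split_ifs with h <;> simp [h]
  simp only [← key]
  clear_value f
  constructor
  · rintro ⟨k, hk⟩
    have := Code.evaln_sound (Option.mem_def.2 hk)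
    rw [Denumerable.ofNat_encode, hc] at this
    simp only [take_initSeg, min_eq_left (Nat.unpair_left_le k)] at this
    exact ⟨k.unpair.1, (Part.mem_some_iff.1 this).symm⟩
  · rintro ⟨t, ht⟩
    have : 1 ∈ Code.eval c (encode ((initSeg (O i) t, initSeg (P i) t), (x, t))) := by
      rw [hc]; exact Part.mem_some_iff.2 ht.symm
    obtain ⟨k, hk⟩ := Code.evaln_complete.1 this
    refine ⟨Nat.pair t k, ?_⟩
    simpa [st, min_eq_left (Nat.left_le_pair t k)] using hk

/-- Recursion theorem for uniformly semidecidable predicates. -/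
theorem S1.fix {Θ : ι → ℕ → α → Prop} (h : S1 O P fun i (q : ℕ × α) => Θ i q.1 q.2) :
    ∃ c, ∀ i a, W (O i) (P i) c (encode a) ↔ Θ i c a := by
  have : S1 O P fun i (q : ℕ × ℕ) => ∃ a : α, decode q.2 = some a ∧ Θ i q.1 a := by
    refine S1.ex (S1.and (S1.prim ?_) (h.comp (g := fun q : (ℕ × ℕ) × α => (q.1.1, q.2))
      (by fun_prop)))
    exact Primrec.eq.comp (Primrec.decode.comp (by fun_prop)) (Primrec.option_some.comp (by fun_prop))
  obtain ⟨c, hc⟩ := S1.fix_nat (Θ := fun i c x => ∃ a : α, decode x = some a ∧ Θ i c a) this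
  exact ⟨c, fun i a => by simp [hc]⟩

theorem S1.index {Φ : ι → α → Prop} (h : S1 O P Φ) :
    ∃ c, ∀ i a, W (O i) (P i) c (encode a) ↔ Φ i a :=
  S1.fix (Θ := fun i _ a => Φ i a) (h.comp (by fun_prop))

/-- Transitivity: a semidecidable predicate may be evaluated through oracles whose graphs are
semidecidable. -/
theorem S1.subst {Q R : κ → ℕ → ℕ} {Φ : κ → α → Prop} (h : S1 Q R Φ)
    {GQ GR : ι → β → ℕ → ℕ → Prop}
    (hQ : S1 O P fun i (q : β × ℕ × ℕ) => GQ i q.1 q.2.1 q.2.2)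
    (hR : S1 O P fun i (q : β × ℕ × ℕ) => GR i q.1 q.2.1 q.2.2) :
    ∃ Ψ : ι → β × α → Prop, S1 O P Ψ ∧ ∀ i b k, (∀ x y, GQ i b x y ↔ Q k x = y) →
      (∀ x y, GR i b x y ↔ R k x = y) → ∀ a, Ψ i (b, a) ↔ Φ k a := by
  obtain ⟨p, hp, h⟩ := h
  refine ⟨fun i q => ∃ s : Str × Str, s.1.length = s.2.length ∧
    (∀ x < s.1.length, GQ i q.1 x (s.1.getD x 0)) ∧
    (∀ x < s.2.length, GR i q.1 x (s.2.getD x 0)) ∧ p (s, (q.2, s.1.length)), ?_, ?_⟩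
  · refine S1.ex (S1.and (S1.prim (by fun_prop)) (S1.and (S1.ball ?_ (by fun_prop))
      (S1.and (S1.ball ?_ (by fun_prop)) (S1.prim (by fun_prop)))))
    · exact hQ.comp (g := fun q : ((β × α) × (Str × Str)) × ℕ =>
        (q.1.1.1, q.2, q.1.2.1.getD q.2 0)) (by fun_prop)
    · exact hR.comp (g := fun q : ((β × α) × (Str × Str)) × ℕ =>
        (q.1.1.1, q.2, q.1.2.2.getD q.2 0)) (by fun_prop)
  · intro i b k h1 h2 a
    simp only [h, h1, h2]
    constructor
    · rintro ⟨⟨σ, τ⟩, h3, h4, h5, h6⟩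
      refine ⟨σ.length, ?_⟩
      simp only at h3 h4 h5 h6
      rw [← eq_initSeg_iff] at h4 h5
      rwa [← h4, h3, ← h5, ← h3]
    · rintro ⟨t, ht⟩
      refine ⟨(initSeg (Q k) t, initSeg (R k) t), by simp, ?_, ?_, by simpa using ht⟩
      · rw [← eq_initSeg_iff]; simp
      · rw [← eq_initSeg_iff]; simp

/-- Uniform decidability relative to a pair of oracles. -/
def D1 {ι : Type*} (O P : ι → ℕ → ℕ) (Φ : ι → α → Prop) : Prop :=
  S1 O P Φ ∧ S1 O P fun i a => ¬ Φ i a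

theorem D1.of_iff {Φ Ψ : ι → α → Prop} (h : D1 O P Φ) (H : ∀ i a, Ψ i a ↔ Φ i a) : D1 O P Ψ :=
  ⟨h.1.of_iff H, h.2.of_iff fun i a => not_congr (H i a)⟩

theorem D1.base {g : α → ℕ} (hg : Primrec g) {p : (Str × Str) × α → Prop} (hp : PrimrecPred p) :
    D1 O P fun i a => p ((initSeg (O i) (g a), initSeg (P i) (g a)), a) :=
  ⟨S1.base hg hp, S1.base hg (p := fun q => ¬ p q) (by fun_prop)⟩

theorem D1.prim {p : α → Prop} (hp : PrimrecPred p) : D1 O P fun _ a => p a :=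
  ⟨S1.prim hp, S1.prim (by fun_prop)⟩

theorem D1.comp {Φ : ι → α → Prop} (h : D1 O P Φ) {g : β → α} (hg : Primrec g) :
    D1 O P fun i b => Φ i (g b) := ⟨h.1.comp hg, h.2.comp hg⟩

theorem D1.not {Φ : ι → α → Prop} (h : D1 O P Φ) : D1 O P fun i a => ¬ Φ i a :=
  ⟨h.2, h.1.of_iff fun _ _ => not_not⟩

theorem D1.and {Φ Ψ : ι → α → Prop} (h : D1 O P Φ) (h' : D1 O P Ψ) :
    D1 O P fun i a => Φ i a ∧ Ψ i a :=
  ⟨h.1.and h'.1, (h.2.or h'.2).of_iff fun _ _ => not_and_or⟩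

theorem D1.or {Φ Ψ : ι → α → Prop} (h : D1 O P Φ) (h' : D1 O P Ψ) :
    D1 O P fun i a => Φ i a ∨ Ψ i a :=
  ⟨h.1.or h'.1, (h.2.and h'.2).of_iff fun _ _ => not_or⟩

theorem D1.imp {Φ Ψ : ι → α → Prop} (h : D1 O P Φ) (h' : D1 O P Ψ) :
    D1 O P fun i a => Φ i a → Ψ i a := (h.not.or h').of_iff fun _ _ => imp_iff_not_or

theorem D1.ball {Φ : ι → α → ℕ → Prop} (h : D1 O P fun i (q : α × ℕ) => Φ i q.1 q.2)
    {g : α → ℕ} (hg : Primrec g) : D1 O P fun i a => ∀ x < g a, Φ i a x :=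
  ⟨h.1.ball hg, (S1.bex (Φ := fun i a x => ¬ Φ i a x) h.2 hg).of_iff fun _ _ => by push Not; rfl⟩

theorem D1.bex {Φ : ι → α → ℕ → Prop} (h : D1 O P fun i (q : α × ℕ) => Φ i q.1 q.2)
    {g : α → ℕ} (hg : Primrec g) : D1 O P fun i a => ∃ x < g a, Φ i a x :=
  ⟨h.1.bex hg, (S1.ball (Φ := fun i a x => ¬ Φ i a x) h.2 hg).of_iff fun _ _ => by push Not; rfl⟩

/-- A jump operator adapted to `W`. -/
noncomputable def J (A : ℕ → ℕ) (p : ℕ) : ℕ := if W A zeroF p.unpair.1 p.unpair.2 then 1 else 0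

theorem S1.jump {Φ : ι → α → Prop} (h : S1 O (fun _ => zeroF) Φ) :
    D1 (fun i => J (O i)) P Φ := by
  obtain ⟨c, hc⟩ := h.index
  have key : ∀ i a, J (O i) (Nat.pair c (encode a)) = if Φ i a then 1 else 0 := by
    intro i a; simp [J, hc]
  constructor
  · refine (S1.query_left (f := fun a => Nat.pair c (encode a)) (g := fun _ => 1) (by fun_prop)
      (by fun_prop)).of_iff fun i a => ?_
    rw [key]; split_ifs with h <;> simp [h]
  · refine (S1.query_left (f := fun a => Nat.pair c (encode a)) (g := fun _ => 0) (by fun_prop)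
      (by fun_prop)).of_iff fun i a => ?_
    rw [key]; split_ifs with h <;> simp [h]

end Semidecidable

section Treemap

variable {α : Type*} [Primcodable α] {ι : Type*} {O P : ι → ℕ → ℕ}

/-- The acceptance of `x` by machine `e` is forced by the finite string `τ`. -/
def forced (A : ℕ → ℕ) (τ : Str) (e x : ℕ) : Prop :=
  ∃ k < τ.length + 1, st (initSeg A k) τ e x k

theorem st_mono {σ τ τ' : Str} {e x k : ℕ} (h : τ <+: τ') (hk : k ≤ τ.length) :
    st σ τ e x k ↔ st σ τ' e x k := by
  obtain ⟨ρ, rfl⟩ := h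
  rw [← st_take (n := τ.length) le_rfl hk, ← st_take (τ := τ ++ ρ) (n := τ.length) le_rfl hk]
  simp

theorem forced.mono {A : ℕ → ℕ} {τ τ' : Str} {e x : ℕ} (h : τ <+: τ') (hf : forced A τ e x) :
    forced A τ' e x := by
  obtain ⟨k, hk, hs⟩ := hf
  have := h.length_le
  exact ⟨k, by omega, (st_mono h (by omega)).1 hs⟩

theorem W_iff_forced {A G : ℕ → ℕ} {e x : ℕ} :
    W A G e x ↔ ∃ m, forced A (initSeg G m) e x := by
  constructor
  · rintro ⟨k, hk⟩
    exact ⟨k, k, by simp, hk⟩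
  · rintro ⟨m, k, hk, hs⟩
    rw [length_initSeg] at hk
    refine ⟨k, (st_initSeg le_rfl (by omega)).1 hs⟩

theorem D1.forced {τ : α → Str} {e x : α → ℕ} (hτ : Primrec τ) (he : Primrec e)
    (hx : Primrec x) : D1 O P fun i a => forced (O i) (τ a) (e a) (x a) := by
  refine D1.bex (D1.base (g := fun q : α × ℕ => q.2)
    (p := fun r => st r.1.1 (τ r.2.1) (e r.2.1) (x r.2.1) r.2.2) ?_ ?_) ?_ <;> fun_prop

/-- The `κ`-th existential fact about the pair `A`, `G`. -/
def fact (A G : ℕ → ℕ) (κ : ℕ) : Prop := ∃ M, W A G κ.unpair.1 (Nat.pair κ.unpair.2 M)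

/-- The `κ`-th existential fact is forced by the finite string `τ`. -/
def forcedFact (A : ℕ → ℕ) (τ : Str) (κ : ℕ) : Prop :=
  ∃ M, forced A τ κ.unpair.1 (Nat.pair κ.unpair.2 M)

theorem forcedFact.mono {A : ℕ → ℕ} {τ τ' : Str} {κ : ℕ} (h : τ <+: τ')
    (hf : forcedFact A τ κ) : forcedFact A τ' κ := hf.imp fun _ => forced.mono h

theorem fact_iff_forcedFact {A G : ℕ → ℕ} {κ : ℕ} :
    fact A G κ ↔ ∃ m, forcedFact A (initSeg G m) κ := by
  simp only [fact, forcedFact, W_iff_forced]; exact exists_comm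

theorem D1.forcedFact {τ : α → Str} {κ : α → ℕ} (hτ : Primrec τ) (hκ : Primrec κ) :
    D1 (fun i => J (O i)) P fun i a => forcedFact (O i) (τ a) (κ a) :=
  S1.jump (S1.ex (D1.forced (by fun_prop) (by fun_prop) (by fun_prop)).1)

/-- `t` codes an extension of `ρ` forcing the fact `κ`, together with a witness. -/
def Forces (A : ℕ → ℕ) (ρ : Str) (κ t : ℕ) : Prop :=
  ρ <+: (Denumerable.ofNat (List ℕ × ℕ) t).1 ∧ forced A (Denumerable.ofNat (List ℕ × ℕ) t).1
    κ.unpair.1 (Nat.pair κ.unpair.2 (Denumerable.ofNat (List ℕ × ℕ) t).2)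

/-- An extension of `ρ` forcing the fact `κ` if there is one, and `ρ` otherwise. -/
noncomputable def ext (A : ℕ → ℕ) (ρ : Str) (κ : ℕ) : Str :=
  if h : ∃ t, Forces A ρ κ t then (Denumerable.ofNat (List ℕ × ℕ) (Nat.find h)).1 else ρ

theorem prefix_ext (A : ℕ → ℕ) (ρ : Str) (κ : ℕ) : ρ <+: ext A ρ κ := by
  unfold ext
  split_ifs with h
  · exact (Nat.find_spec h).1
  · exact List.prefix_rfl

theorem forcedFact_ext {A : ℕ → ℕ} {ρ τ : Str} {κ : ℕ} (h : ρ <+: τ) (hf : forcedFact A τ κ) :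
    forcedFact A (ext A ρ κ) κ := by
  obtain ⟨M, hM⟩ := hf
  have : ∃ t, Forces A ρ κ t := ⟨encode (τ, M), by simp [Forces, h, hM]⟩
  rw [ext, dif_pos this]
  exact ⟨_, (Nat.find_spec this).2⟩

theorem S1.ext_eq {ρ τ : α → Str} {κ : α → ℕ} (hρ : Primrec ρ) (hτ : Primrec τ)
    (hκ : Primrec κ) : S1 (fun i => J (O i)) P fun i a => ext (O i) (ρ a) (κ a) = τ a := by
  have hD (Q : ι → ℕ → ℕ) : D1 O Q fun i (q : α × ℕ) => Forces (O i) (ρ q.1) (κ q.1) q.2 :=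
    (D1.prim (by fun_prop)).and (D1.forced (by fun_prop) (by fun_prop) (by fun_prop))
  have hE : D1 (fun i => J (O i)) P fun i a => ∃ t, Forces (O i) (ρ a) (κ a) t :=
    S1.jump (S1.ex (hD _).1)
  have hD' : D1 (fun i => J (O i)) P fun i (q : α × ℕ) => Forces (O i) (ρ q.1) (κ q.1) q.2 :=
    S1.jump (hD _).1
  refine S1.of_iff (Φ := fun i a => (∃ t, Forces (O i) (ρ a) (κ a) t ∧
    (∀ s < t, ¬ Forces (O i) (ρ a) (κ a) s) ∧ (Denumerable.ofNat (List ℕ × ℕ) t).1 = τ a) ∨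
    ((¬ ∃ t, Forces (O i) (ρ a) (κ a) t) ∧ ρ a = τ a)) ?_ fun i a => ?_
  · refine S1.or (S1.ex (S1.and hD'.1 (S1.and (S1.ball ?_ ?_) (S1.prim ?_))))
      (hE.2.and (S1.prim ?_))
    · exact hD'.2.comp (g := fun q : (α × ℕ) × ℕ => (q.1.1, q.2)) (by fun_prop)
    all_goals fun_prop
  · constructor
    · intro h
      by_cases hx : ∃ t, Forces (O i) (ρ a) (κ a) t
      · rw [ext, dif_pos hx] at h
        exact Or.inl ⟨_, Nat.find_spec hx, fun s => Nat.find_min hx, h⟩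
      · rw [ext, dif_neg hx] at h
        exact Or.inr ⟨hx, h⟩
    · rintro (⟨t, h1, h2, h3⟩ | ⟨h1, h2⟩)
      · have hx : ∃ t, Forces (O i) (ρ a) (κ a) t := ⟨t, h1⟩
        rw [ext, dif_pos hx, (Nat.find_eq_iff hx).2 ⟨h1, h2⟩, h3]
      · rw [ext, dif_neg h1, h2]

/-- The treemap whose `k`-th block `i` decides the fact `i.unpair.1`. -/
noncomputable def F (A : ℕ → ℕ) (σ : Str) : Str :=
  σ.foldl (fun ρ i => ext A (ρ ++ [i]) i.unpair.1) []

@[simp] theorem F_nil (A : ℕ → ℕ) : F A [] = [] := rfl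

theorem F_concat (A : ℕ → ℕ) (σ : Str) (i : ℕ) :
    F A (σ ++ [i]) = ext A (F A σ ++ [i]) i.unpair.1 := by simp [F]

theorem F_concat_mono (A : ℕ → ℕ) (σ : Str) (i : ℕ) : F A σ ++ [i] <+: F A (σ ++ [i]) := by
  rw [F_concat]; exact prefix_ext _ _ _

theorem F_mono {A : ℕ → ℕ} {σ τ : Str} (h : σ <+: τ) : F A σ <+: F A τ := by
  obtain ⟨ρ, rfl⟩ := h
  induction ρ using List.reverseRecOn with
  | nil => simp
  | append_singleton ρ i ih =>
    rw [← List.append_assoc]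
    exact ih.trans ((List.prefix_append _ _).trans (F_concat_mono A _ i))

theorem length_le_F (A : ℕ → ℕ) (σ : Str) : σ.length ≤ (F A σ).length := by
  induction σ using List.reverseRecOn with
  | nil => simp
  | append_singleton ρ i ih =>
    have := (F_concat_mono A ρ i).length_le
    simp at this ⊢; omega

theorem take_succ_getD {σ : Str} {i : ℕ} (h : i < σ.length) :
    σ.take (i + 1) = σ.take i ++ [σ.getD i 0] := by
  rw [List.take_add_one]; simp [h]

theorem S1.F_eq {σ ρ : α → Str} (hσ : Primrec σ) (hρ : Primrec ρ) :
    S1 (fun i => J (O i)) P fun i a => F (O i) (σ a) = ρ a := by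
  refine S1.of_iff (Φ := fun i a => ∃ L : List Str, L.getD 0 [] = [] ∧
    L.getD (σ a).length [] = ρ a ∧ ∀ j < (σ a).length,
      ext (O i) (L.getD j [] ++ [(σ a).getD j 0]) ((σ a).getD j 0).unpair.1 =
        L.getD (j + 1) []) ?_ fun i a => ?_
  · refine S1.ex (S1.and (S1.prim ?_) (S1.and (S1.prim ?_) (S1.ball (S1.ext_eq ?_ ?_ ?_) ?_))) <;>
    fun_prop
  · constructor
    · intro h
      refine ⟨(List.range ((σ a).length + 1)).map fun j => F (O i) ((σ a).take j), ?_, ?_, ?_⟩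
      · simp
      · simp [h]
      · intro j hj
        simp only [List.getD_eq_getElem?_getD, List.getElem?_map]
        rw [List.getElem?_range (by omega), List.getElem?_range (by omega)]
        simp only [Option.map_some, Option.getD_some]
        rw [take_succ_getD hj, F_concat]
        simp [hj]
    · rintro ⟨L, h0, h1, h2⟩
      have : ∀ j ≤ (σ a).length, F (O i) ((σ a).take j) = L.getD j [] := by
        intro j
        induction j with
        | zero => intro _; simpa using h0.symm
        | succ j ih =>
          intro hj
          rw [take_succ_getD (by omega), F_concat, ih (by omega), h2 j (by omega)]
      rw [← h1, ← this _ le_rfl, List.take_length]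

/-- The map on paths induced by `F`. -/
noncomputable def Fpath (A Z : ℕ → ℕ) (k : ℕ) : ℕ := (F A (initSeg Z (k + 1))).getD k 0

theorem prefix_getD {σ τ : Str} (h : σ <+: τ) {i : ℕ} (hi : i < σ.length) :
    τ.getD i 0 = σ.getD i 0 := by
  obtain ⟨ρ, rfl⟩ := h
  rw [List.getD_append _ _ _ _ hi]

theorem F_eq_initSeg (A Z : ℕ → ℕ) (k : ℕ) :
    F A (initSeg Z k) = initSeg (Fpath A Z) (F A (initSeg Z k)).length := by
  rw [eq_initSeg_iff]
  intro i hi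
  have h := length_le_F A (initSeg Z (i + 1))
  rw [length_initSeg] at h
  unfold Fpath
  rcases le_total (i + 1) k with h' | h'
  · rw [prefix_getD (F_mono (initSeg_mono Z h')) (by omega)]
  · rw [prefix_getD (F_mono (initSeg_mono Z h')) hi]

theorem prefix_initSeg_iff {X : ℕ → ℕ} {σ : Str} {n : ℕ} :
    σ <+: initSeg X n ↔ σ.length ≤ n ∧ σ = initSeg X σ.length := by
  constructor
  · intro h
    have := h.length_le
    rw [length_initSeg] at this
    refine ⟨this, ?_⟩
    conv_lhs => rw [List.prefix_iff_eq_take.1 h]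
    simp [this]
  · rintro ⟨h, h'⟩
    rw [h']; exact initSeg_mono X h

/-- `σ` is an initial segment of `X`. -/
def Seg (σ : Str) (X : ℕ → ℕ) : Prop := σ = initSeg X σ.length

theorem seg_initSeg (X : ℕ → ℕ) (n : ℕ) : Seg (initSeg X n) X := by simp [Seg]

theorem Seg.mono_left {σ τ : Str} {X : ℕ → ℕ} (h : Seg τ X) (hp : σ <+: τ) : Seg σ X := by
  rw [Seg] at h
  rw [h] at hp
  exact (prefix_initSeg_iff.1 hp).2

theorem Seg.getD {σ : Str} {X : ℕ → ℕ} (h : Seg σ X) {i : ℕ} (hi : i < σ.length) :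
    σ.getD i 0 = X i := (eq_initSeg_iff.1 h i hi).symm

theorem seg_concat {σ : Str} {X : ℕ → ℕ} {i : ℕ} :
    Seg (σ ++ [i]) X ↔ Seg σ X ∧ X σ.length = i := by
  constructor
  · intro h
    refine ⟨h.mono_left (List.prefix_append _ _), ?_⟩
    rw [← h.getD (by simp)]; simp
  · rintro ⟨h, rfl⟩
    rw [Seg, List.length_append, List.length_singleton, initSeg_succ, ← h]

theorem seg_F (A Z : ℕ → ℕ) (k : ℕ) : Seg (F A (initSeg Z k)) (Fpath A Z) := F_eq_initSeg A Z k

theorem seg_of_seg_F {A Z : ℕ → ℕ} {σ : Str} (h : Seg (F A σ) (Fpath A Z)) : Seg σ Z := by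
  induction σ using List.reverseRecOn with
  | nil => simp [Seg]
  | append_singleton σ i ih =>
    have h1 := h.mono_left (F_concat_mono A σ i)
    have h2 := ih (seg_concat.1 h1).1
    refine seg_concat.2 ⟨h2, ?_⟩
    have h3 := (seg_F A Z (σ.length + 1))
    rw [initSeg_succ, ← h2] at h3
    have h4 := h3.mono_left (F_concat_mono A σ _)
    rw [← (seg_concat.1 h1).2, (seg_concat.1 h4).2]

theorem Fpath_injective {A Z Z' : ℕ → ℕ} (h : Fpath A Z = Fpath A Z') : Z = Z' := by
  funext k
  have h1 := seg_F A Z (k + 1)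
  rw [h] at h1
  have h2 := seg_of_seg_F h1
  rw [Seg, length_initSeg] at h2
  exact initSeg_inj h2 (Nat.lt_succ_self k)

theorem Fpath_congr {A Z Z' : ℕ → ℕ} {n : ℕ} (h : ∀ i < n, Z i = Z' i) :
    ∀ i < n, Fpath A Z i = Fpath A Z' i := by
  intro i hi
  rw [Fpath, Fpath, initSeg_congr fun j hj => h j (by omega)]

theorem Fpath_zero (A Z : ℕ → ℕ) : Fpath A Z 0 = Z 0 := by
  have h := (seg_F A Z 1)
  rw [initSeg_succ] at h
  exact (seg_concat.1 (h.mono_left (F_concat_mono A _ _))).2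

theorem exists_Fpath_eq {A G : ℕ → ℕ}
    (h : ∀ σ, Seg (F A σ) G → Seg (F A (σ ++ [G (F A σ).length])) G) :
    ∃ Z, G = Fpath A Z ∧ ∀ k, Seg (F A (initSeg Z k)) G := by
  let s : ℕ → Str := fun k => k.rec [] fun _ σ => σ ++ [G (F A σ).length]
  have hs : ∀ k, Seg (F A (s k)) G := by
    intro k
    induction k with
    | zero => simp [s, Seg]
    | succ k ih => exact h _ ih
  have hZ : ∀ k, s k = initSeg (fun k => G (F A (s k)).length) k := by
    intro k
    induction k with
    | zero => rfl
    | succ k ih => rw [initSeg_succ, ← ih]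
  have hs' : ∀ k, Seg (F A (initSeg (fun k => G (F A (s k)).length) k)) G := by
    intro k; rw [← hZ]; exact hs k
  refine ⟨fun k => G (F A (s k)).length, ?_, hs'⟩
  funext k
  rw [Fpath, (hs' (k + 1)).getD]
  have := length_le_F A (initSeg (fun k => G (F A (s k)).length) (k + 1))
  rw [length_initSeg] at this
  omega

theorem fact_Fpath_iff {A Z : ℕ → ℕ} {κ k : ℕ} (h : (Z k).unpair.1 = κ) :
    fact A (Fpath A Z) κ ↔ forcedFact A (F A (initSeg Z (k + 1))) κ := by
  rw [fact_iff_forcedFact]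
  constructor
  · rintro ⟨m, hm⟩
    rw [initSeg_succ, F_concat, h]
    set ρ := F A (initSeg Z k) ++ [Z k]
    have hρ : Seg ρ (Fpath A Z) := by
      refine (seg_F A Z (k + 1)).mono_left ?_
      rw [initSeg_succ]
      exact F_concat_mono A _ _
    refine forcedFact_ext (τ := initSeg (Fpath A Z) (ρ.length + m)) ?_
      (hm.mono (initSeg_mono _ (by omega)))
    rw [prefix_initSeg_iff]
    exact ⟨by omega, hρ⟩
  · intro h'
    exact ⟨_, by rwa [← F_eq_initSeg]⟩

end Treemap

section Tools

variable {α β : Type*} [Primcodable α] [Primcodable β] {ι : Type*} {O P : ι → ℕ → ℕ}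

theorem S1.bind {f : ι → α → β} (hf : S1 O P fun i (q : α × β) => f i q.1 = q.2)
    {Θ : ι → α → β → Prop} (hΘ : S1 O P fun i (q : α × β) => Θ i q.1 q.2) :
    S1 O P fun i a => Θ i a (f i a) :=
  (S1.ex (Φ := fun i a b => f i a = b ∧ Θ i a b) (hf.and hΘ)).of_iff fun i a => by simp

theorem S1.change {Q R : ι → ℕ → ℕ} {Φ : ι → α → Prop} (h : S1 Q R Φ)
    (hQ : S1 O P fun i (q : ℕ × ℕ) => Q i q.1 = q.2)
    (hR : S1 O P fun i (q : ℕ × ℕ) => R i q.1 = q.2) : S1 O P Φ := by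
  obtain ⟨Ψ, hΨ, H⟩ := h.subst (β := Unit) (O := O) (P := P) (GQ := fun i _ x y => Q i x = y)
    (GR := fun i _ x y => R i x = y) (hQ.comp (by fun_prop)) (hR.comp (by fun_prop))
  exact (hΨ.comp (g := fun a => ((), a)) (by fun_prop)).of_iff fun i a =>
    (H i () i (fun _ _ => Iff.rfl) (fun _ _ => Iff.rfl) a).symm

/-- The even part of a point of Baire space. -/
def evenF (X : ℕ → ℕ) (k : ℕ) : ℕ := X (2 * k)

/-- The even part of a string. -/
def evens (π : Str) : Str := (List.range (π.length / 2)).map fun i => π.getD (2 * i) 0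

@[fun_prop] theorem primrec_evens {f : α → Str} (hf : Primrec f) :
    Primrec fun a => evens (f a) := by
  unfold evens; fun_prop

theorem Seg.evens {π : Str} {X : ℕ → ℕ} (h : Seg π X) : Seg (evens π) (evenF X) := by
  have : (Harrington.evens π).length = π.length / 2 := by simp [Harrington.evens]
  rw [Seg, this, Harrington.evens, initSeg]
  refine List.map_congr_left fun i hi => ?_
  rw [List.mem_range] at hi
  rw [h.getD (by omega), evenF]

theorem evens_initSeg (X : ℕ → ℕ) (k : ℕ) : evens (initSeg X (2 * k)) = initSeg (evenF X) k := by
  have := (seg_initSeg X (2 * k)).evens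
  rw [Seg] at this
  rw [this]; simp [evens]

theorem S1.even {Φ : ι → α → Prop} (h : S1 O (fun i => evenF (P i)) Φ) : S1 O P Φ :=
  h.change (S1.query_left (by fun_prop) (by fun_prop))
    (S1.query_right (f := fun q : ℕ × ℕ => 2 * q.1) (by fun_prop) (by fun_prop))

/-- Prepend `z` to `X` and tag the remaining entries with their positions. -/
def Zof (z : ℕ) (X : ℕ → ℕ) (k : ℕ) : ℕ := k.casesOn z fun j => Nat.pair j (X j)

/-- The finite version of `Zof`. -/
def zseg (z : ℕ) (τ : Str) : Str :=
  z :: (List.range τ.length).map fun i => Nat.pair i (τ.getD i 0)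

@[fun_prop] theorem primrec_zseg {z : α → ℕ} {f : α → Str} (hz : Primrec z) (hf : Primrec f) :
    Primrec fun a => zseg (z a) (f a) := by
  unfold zseg; fun_prop

theorem initSeg_Zof (z : ℕ) (X : ℕ → ℕ) (k : ℕ) :
    initSeg (Zof z X) (k + 1) = zseg z (initSeg X k) := by
  rw [initSeg, List.range_succ_eq_map, List.map_cons, List.map_map, zseg, length_initSeg]
  congr 1
  refine List.map_congr_left fun i hi => ?_
  rw [getD_initSeg (List.mem_range.1 hi)]; rfl

/-- Forget the first entry and the position tags. -/
def vals (σ : Str) : Str := σ.tail.map fun i => i.unpair.2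

@[fun_prop] theorem primrec_vals {f : α → Str} (hf : Primrec f) :
    Primrec fun a => vals (f a) := by
  unfold vals; fun_prop

theorem vals_zseg (z : ℕ) (X : ℕ → ℕ) (k : ℕ) : vals (zseg z (initSeg X k)) = initSeg X k := by
  simp only [vals, zseg, List.tail_cons, List.map_map, length_initSeg]
  rw [initSeg]
  refine List.map_congr_left fun i hi => ?_
  simp only [Function.comp, Nat.unpair_pair]
  exact getD_initSeg (List.mem_range.1 hi) 0

theorem Seg.vals {σ : Str} {z : ℕ} {X : ℕ → ℕ} (h : Seg σ (Zof z X)) : Seg (vals σ) X := by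
  rw [Seg] at h
  rcases hl : σ.length with _ | k
  · simp [List.length_eq_zero_iff.1 hl, Harrington.vals, Seg]
  · rw [hl, initSeg_Zof] at h
    rw [h, vals_zseg]; exact seg_initSeg X k

theorem Zof_injective {z : ℕ} {X X' : ℕ → ℕ} (h : Zof z X = Zof z X') : X = X' := by
  funext k
  have := congrFun h (k + 1)
  simpa [Zof] using this

theorem Zof_congr {z n : ℕ} {X X' : ℕ → ℕ} (h : ∀ i < n, X i = X' i) :
    ∀ i < n + 1, Zof z X i = Zof z X' i := by
  intro i hi
  cases i with
  | zero => rfl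
  | succ i => simp only [Zof]; rw [h i (by omega)]

end Tools

section Witnesses

variable {α : Type*} [Primcodable α] {ι : Type*} {O P : ι → ℕ → ℕ}

/-- The jump of `A` is seen to contain `i` at stage `t`. -/
def jst (A : ℕ → ℕ) (t i : ℕ) : Prop :=
  st (initSeg A t) (initSeg zeroF t) i.unpair.1 i.unpair.2 t

theorem J_eq_ite (A : ℕ → ℕ) (i : ℕ) : J A i = if ∃ t, jst A t i then 1 else 0 := rfl

/-- The first components of a triple code `x`: a stage, a witness and a guess at a finite part of
the jump in which positive entries carry stages. -/
def guess (x : ℕ) : ℕ × ℕ × List ℕ := Denumerable.ofNat _ x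

@[fun_prop] theorem primrec_guess {f : α → ℕ} (hf : Primrec f) :
    Primrec fun a => guess (f a) := by unfold guess; fun_prop

/-- The guess coded by `x` makes machine `b` accept and its positive part is correct. -/
def prem (b : ℕ) (A G : ℕ → ℕ) (v : ℕ × ℕ × ℕ) (x : ℕ) : Prop :=
  (guess x).1 < (guess x).2.2.length + 1 ∧
  st ((guess x).2.2.map fun y => if y = 0 then 0 else 1) (initSeg G (guess x).1) b
    (encode (v, (guess x).2.1)) (guess x).1 ∧
  ∀ i < (guess x).2.2.length, (guess x).2.2.getD i 0 = 0 ∨ jst A ((guess x).2.2.getD i 0 - 1) i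

/-- The negative part of the guess coded by `x` is refuted at stage `t`. -/
def refuted (A : ℕ → ℕ) (x t : ℕ) : Prop :=
  ∃ i < (guess x).2.2.length, (guess x).2.2.getD i 0 = 0 ∧ jst A t i

/-- If the guess coded by `x` looks right then it is refuted at stage `t`. -/
def psi (b : ℕ) (A G : ℕ → ℕ) (v : ℕ × ℕ × ℕ) (x t : ℕ) : Prop := prem b A G v x → refuted A x t

theorem D1.jst {t i : α → ℕ} (ht : Primrec t) (hi : Primrec i) :
    D1 O P fun j a => jst (O j) (t a) (i a) := by
  refine D1.base (g := t) (p := fun r => st r.1.1 (initSeg zeroF (t r.2)) (i r.2).unpair.1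
    (i r.2).unpair.2 (t r.2)) ht ?_
  have : Primrec (initSeg zeroF) := by unfold initSeg zeroF; fun_prop
  fun_prop

theorem D1.psi {b x t : α → ℕ} {v : α → ℕ × ℕ × ℕ} (hb : Primrec b) (hx : Primrec x)
    (ht : Primrec t) (hv : Primrec v) :
    D1 O P fun j a => psi (b a) (O j) (P j) (v a) (x a) (t a) := by
  refine D1.imp (D1.and (D1.prim ?_) (D1.and (D1.base (g := fun a => (guess (x a)).1)
    (p := fun r => st ((guess (x r.2)).2.2.map fun y => if y = 0 then 0 else 1) r.1.2 (b r.2)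
    (encode (v r.2, (guess (x r.2)).2.1)) (guess (x r.2)).1) ?_ ?_)
    (D1.ball (D1.or (D1.prim ?_) (D1.jst ?_ ?_)) ?_)))
    (D1.bex (D1.and (D1.prim ?_) (D1.jst ?_ ?_)) ?_) <;> fun_prop

theorem exists_psi_iff {b : ℕ} {A G : ℕ → ℕ} {v : ℕ × ℕ × ℕ} :
    (∀ x, ∃ t, psi b A G v x t) ↔ ¬ ∃ M : ℕ, W (J A) G b (encode (v, M)) := by
  constructor
  · rintro H ⟨M, k, hk⟩
    have : ∀ i, ∃ y, (J A i = if y = 0 then 0 else 1) ∧ (y = 0 ∨ jst A (y - 1) i) := by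
      intro i
      by_cases h : ∃ t, jst A t i
      · exact ⟨h.choose + 1, by rw [J_eq_ite, if_pos h]; simp, Or.inr h.choose_spec⟩
      · exact ⟨0, by rw [J_eq_ite, if_neg h]; simp, Or.inl rfl⟩
    choose U hU1 hU2 using this
    obtain ⟨t, ht⟩ := H (encode (k, M, initSeg U k))
    have hg : guess (encode (k, M, initSeg U k)) = (k, M, initSeg U k) :=
      Denumerable.ofNat_encode _
    have hmap : (initSeg U k).map (fun y => if y = 0 then 0 else 1) = initSeg (J A) k := by
      rw [initSeg, List.map_map, initSeg]
      exact List.map_congr_left fun i _ => (hU1 i).symm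
    obtain ⟨i, hi, h1, h2⟩ := ht (by
      rw [prem, hg]
      refine ⟨by simp, by simpa only [hmap] using hk, fun i hi => ?_⟩
      rw [length_initSeg] at hi
      simp only [getD_initSeg hi]
      exact hU2 i)
    rw [hg] at hi h1
    simp only [length_initSeg] at hi
    simp only [getD_initSeg hi] at h1
    have := hU1 i
    rw [h1, J_eq_ite, if_pos ⟨t, h2⟩] at this
    simp at this
  · intro H x
    by_contra! hx
    have hp : prem b A G v x := by
      by_contra hp; exact hx 0 fun h => absurd h hp
    have hr : ∀ t, ¬ refuted A x t := fun t ht => hx t fun _ => ht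
    obtain ⟨h1, h2, h3⟩ := hp
    refine H ⟨(guess x).2.1, (guess x).1, ?_⟩
    have hmap : (guess x).2.2.map (fun y => if y = 0 then 0 else 1) =
        initSeg (J A) (guess x).2.2.length := by
      apply List.ext_getElem
      · simp
      · intro i hi hi'
        have hi : i < (guess x).2.2.length := by simpa using hi
        have h3 := h3 i hi
        rw [List.getD_eq_getElem _ _ hi] at h3
        simp only [List.getElem_map, getElem_initSeg, J_eq_ite]
        by_cases hy : (guess x).2.2[i] = 0
        · rw [if_pos hy, if_neg]
          rintro ⟨t, ht⟩
          exact hr t ⟨i, hi, by rw [List.getD_eq_getElem _ _ hi, hy], ht⟩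
        · rw [if_neg hy, if_pos ⟨_, h3.resolve_left hy⟩]
    rw [hmap] at h2
    rw [← st_take le_rfl le_rfl] at h2
    simpa [min_eq_left (Nat.lt_succ_iff.1 h1)] using h2

/-- `t` is the least witness for `x`. -/
def IsWit (b : ℕ) (A G : ℕ → ℕ) (v : ℕ × ℕ × ℕ) (x t : ℕ) : Prop :=
  psi b A G v x t ∧ ∀ s < t, ¬ psi b A G v x s

theorem D1.isWit {b x t : α → ℕ} {v : α → ℕ × ℕ × ℕ} (hb : Primrec b) (hx : Primrec x)
    (ht : Primrec t) (hv : Primrec v) :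
    D1 O P fun j a => IsWit (b a) (O j) (P j) (v a) (x a) (t a) := by
  refine (D1.psi hb hx ht hv).and (D1.ball (D1.not (D1.psi ?_ ?_ ?_ ?_)) ht) <;> fun_prop

/-- The least witness for `x`, if any. -/
noncomputable def wit (b : ℕ) (A G : ℕ → ℕ) (v : ℕ × ℕ × ℕ) (x : ℕ) : ℕ :=
  if h : ∃ t, psi b A G v x t then Nat.find h else 0

theorem wit_eq_iff {b : ℕ} {A G : ℕ → ℕ} {v : ℕ × ℕ × ℕ} {x : ℕ} (h : ∃ t, psi b A G v x t)
    {t : ℕ} : wit b A G v x = t ↔ IsWit b A G v x t := by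
  rw [wit, dif_pos h, Nat.find_eq_iff]; rfl

theorem psi_congr {b : ℕ} {A G G' : ℕ → ℕ} {v : ℕ × ℕ × ℕ} {x : ℕ}
    (h : ∀ i < x, G i = G' i) : psi b A G v x = psi b A G' v x := by
  have hx : (guess x).1 ≤ x := by
    have : encode (guess x) = x := Denumerable.encode_ofNat x
    conv_rhs => rw [← this]
    exact Nat.left_le_pair _ _
  have : prem b A G v x = prem b A G' v x := by
    rw [prem, prem, initSeg_congr fun i hi => h i (lt_of_lt_of_le hi hx)]
  funext t
  rw [psi, psi, this]

/-- Interleave `G` with witnesses. -/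
noncomputable def mk (b : ℕ) (A G : ℕ → ℕ) (n d p : ℕ) : ℕ :=
  if p % 2 = 0 then G (p / 2) else wit b A G ((p / 2).unpair.1, n, d) (p / 2).unpair.2

theorem evenF_mk (b : ℕ) (A G : ℕ → ℕ) (n d : ℕ) : evenF (mk b A G n d) = G := by
  funext k; simp [evenF, mk]

theorem mk_odd (b : ℕ) (A G : ℕ → ℕ) (n d j x : ℕ) :
    mk b A G n d (2 * Nat.pair j x + 1) = wit b A G (j, n, d) x := by
  have h1 : (2 * Nat.pair j x + 1) % 2 = 1 := by omega
  have h2 : (2 * Nat.pair j x + 1) / 2 = Nat.pair j x := by omega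
  simp [mk, h1, h2]

theorem mk_congr {b n d k : ℕ} {A G G' : ℕ → ℕ} (h : ∀ i < k + 1, G i = G' i) :
    ∀ p < k + 1, mk b A G n d p = mk b A G' n d p := by
  intro p hp
  unfold mk wit
  have := Nat.unpair_right_le (p / 2)
  rw [h (p / 2) (by omega), psi_congr fun i hi => h i (by omega)]

/-- All witnesses exist. -/
def Good (b : ℕ) (A G : ℕ → ℕ) (n d : ℕ) : Prop := ∀ j x, ∃ t, psi b A G (j, n, d) x t

/-- The entry of `X` for `x` in the column below `v.2.1` is not the least witness. -/
def Bad (A X : ℕ → ℕ) (v : ℕ × ℕ × ℕ × ℕ) (x : ℕ) : Prop :=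
  v.2.1 ≠ 0 ∧ ¬ IsWit v.1 A (evenF X) (v.2.1 - 1, v.2.2) x (X (2 * Nat.pair (v.2.1 - 1) x + 1))

theorem S1.not_isWit_evenF {b x t : α → ℕ} {v : α → ℕ × ℕ × ℕ} (hb : Primrec b)
    (hx : Primrec x) (ht : Primrec t) (hv : Primrec v) :
    S1 O P fun i a => ¬ IsWit (b a) (O i) (evenF (P i)) (v a) (x a) (t a) :=
  S1.even (D1.isWit (P := fun i => evenF (P i)) hb hx ht hv).2

theorem S1.bad : S1 O P fun i (q : (ℕ × ℕ × ℕ × ℕ) × ℕ) => Bad (O i) (P i) q.1 q.2 := by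
  have h : S1 O P fun i (q : ((ℕ × ℕ × ℕ × ℕ) × ℕ) × ℕ) =>
      ¬ IsWit q.1.1.1 (O i) (evenF (P i)) (q.1.1.2.1 - 1, q.1.1.2.2) q.1.2 q.2 := by
    refine S1.not_isWit_evenF ?_ ?_ ?_ ?_ <;> fun_prop
  have h' : S1 O P fun i (q : ((ℕ × ℕ × ℕ × ℕ) × ℕ) × ℕ) =>
      P i (2 * Nat.pair (q.1.1.2.1 - 1) q.1.2 + 1) = q.2 := by
    refine S1.query_right ?_ ?_ <;> fun_prop
  have h2 := S1.bind (f := fun (i : ι) (q : (ℕ × ℕ × ℕ × ℕ) × ℕ) =>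
    P i (2 * Nat.pair (q.1.2.1 - 1) q.2 + 1))
    (Θ := fun (i : ι) (q : (ℕ × ℕ × ℕ × ℕ) × ℕ) (y : ℕ) =>
      ¬ IsWit q.1.1 (O i) (evenF (P i)) (q.1.2.1 - 1, q.1.2.2) q.2 y) h' h
  exact S1.and (S1.prim (by fun_prop)) h2

theorem exists_eBad : ∃ e, ∀ A X v x, W A X e (encode (v, x)) ↔ Bad A X v x := by
  obtain ⟨e, he⟩ := (S1.bad (O := (Prod.fst : (ℕ → ℕ) × (ℕ → ℕ) → _)) (P := Prod.snd)).index
  exact ⟨e, fun A X v x => he (A, X) (v, x)⟩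

/-- An index for `Bad`. -/
noncomputable def eBad : ℕ := exists_eBad.choose

theorem W_eBad {A X : ℕ → ℕ} {v : ℕ × ℕ × ℕ × ℕ} {x : ℕ} :
    W A X eBad (encode (v, x)) ↔ Bad A X v x := exists_eBad.choose_spec A X v x

theorem exists_eR : ∃ e', ∀ A G b e n d a M, Good b A G n d →
    (W A G e' (encode ((b, e, n, d, a), M)) ↔ W A (mk b A G n d) e (Nat.pair a M)) := by
  have hU : S1 (Prod.fst : (ℕ → ℕ) × (ℕ → ℕ) → _) Prod.snd
      fun i (q : ℕ × ℕ) => W i.1 i.2 q.1 q.2 := S1.univ (by fun_prop) (by fun_prop)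
  obtain ⟨Ψ, hΨ, H⟩ := hU.subst (β := ℕ × ℕ × ℕ)
    (O := (Prod.fst : (ℕ → ℕ) × (ℕ → ℕ) → _)) (P := Prod.snd) (GQ := fun i _ x y => i.1 x = y)
    (GR := fun i (b : ℕ × ℕ × ℕ) x y => x % 2 = 0 ∧ i.2 (x / 2) = y ∨ x % 2 ≠ 0 ∧
      IsWit b.1 i.1 i.2 ((x / 2).unpair.1, b.2) (x / 2).unpair.2 y)
    (S1.query_left (by fun_prop) (by fun_prop)) (by
      refine S1.or (S1.and (S1.prim ?_) (S1.query_right (f := fun q : (ℕ × ℕ × ℕ) × ℕ × ℕ =>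
        q.2.1 / 2) ?_ ?_)) (S1.and (S1.prim ?_) (D1.isWit ?_ ?_ ?_ ?_).1) <;> fun_prop)
  obtain ⟨e', he'⟩ := (hΨ.comp (g := fun q : (ℕ × ℕ × ℕ × ℕ × ℕ) × ℕ =>
    ((q.1.1, q.1.2.2.1, q.1.2.2.2.1), (q.1.2.1, Nat.pair q.1.2.2.2.2 q.2))) (by fun_prop)).index
  refine ⟨e', fun A G b e n d a M hG => (he' (A, G) ((b, e, n, d, a), M)).trans
    (H (A, G) (b, n, d) (A, mk b A G n d) (fun _ _ => Iff.rfl) (fun x y => ?_) _)⟩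
  simp only [mk]
  split_ifs with h
  · simp [h]
  · rw [wit_eq_iff (hG _ _)]; simp only [h, false_and, false_or, ne_eq, not_false_eq_true, true_and]

/-- An index for acceptance relative to the interleaving with witnesses. -/
noncomputable def eR : ℕ := exists_eR.choose

theorem W_eR {A G : ℕ → ℕ} {b e n d a M : ℕ} (h : Good b A G n d) :
    W A G eR (encode ((b, e, n, d, a), M)) ↔ W A (mk b A G n d) e (Nat.pair a M) :=
  exists_eR.choose_spec A G b e n d a M h

/-- The fact that machine `e` accepts some `Nat.pair a M`, relative to the interleaving. -/
noncomputable def kap (b e n d a : ℕ) : ℕ := Nat.pair eR (encode (b, e, n, d, a))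

@[fun_prop] theorem primrec_kap {b e n d a : α → ℕ} (hb : Primrec b) (he : Primrec e)
    (hn : Primrec n) (hd : Primrec d) (ha : Primrec a) :
    Primrec fun q => kap (b q) (e q) (n q) (d q) (a q) := by
  unfold kap; fun_prop

theorem W_kap {A G : ℕ → ℕ} {b e n d a M : ℕ} (h : Good b A G n d) :
    W A G (kap b e n d a).unpair.1 (Nat.pair (kap b e n d a).unpair.2 M) ↔
      W A (mk b A G n d) e (Nat.pair a M) := by
  rw [← W_eR h, kap, Nat.unpair_pair, Encodable.encode_prod_val]; rfl

theorem fact_kap {A G : ℕ → ℕ} {b e n d a : ℕ} (h : Good b A G n d) :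
    fact A G (kap b e n d a) ↔ ∃ M, W A (mk b A G n d) e (Nat.pair a M) :=
  exists_congr fun _ => W_kap h

end Witnesses

section Recursion

variable {α : Type*} [Primcodable α] {ι : Type*} {O P : ι → ℕ → ℕ}

theorem D1.seg {τ : α → Str} (hτ : Primrec τ) : D1 O P fun i a => Seg (τ a) (P i) :=
  D1.base (g := fun a => (τ a).length) (p := fun r => τ r.2 = r.1.2) (by fun_prop) (by fun_prop)

theorem S1.initSeg_eq {k : α → ℕ} {ρ : α → Str} (hk : Primrec k) (hρ : Primrec ρ) :
    S1 O P fun i a => initSeg (P i) (k a) = ρ a :=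
  S1.base (g := k) (p := fun r => r.1.2 = ρ r.2) (by fun_prop) (by fun_prop)

/-- One plus the least witness for the fact `κ` forced by `τ`, or `0` if there is none. -/
noncomputable def forcedWit (A : ℕ → ℕ) (τ : Str) (κ : ℕ) : ℕ :=
  if h : ∃ M, forced A τ κ.unpair.1 (Nat.pair κ.unpair.2 M) then Nat.find h + 1 else 0

theorem S1.forcedWit_eq {τ : α → Str} {κ z : α → ℕ} (hτ : Primrec τ) (hκ : Primrec κ)
    (hz : Primrec z) : S1 (fun i => J (O i)) P fun i a => forcedWit (O i) (τ a) (κ a) = z a := by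
  have hD (Q : ι → ℕ → ℕ) : D1 O Q fun i (q : α × ℕ) =>
      forced (O i) (τ q.1) (κ q.1).unpair.1 (Nat.pair (κ q.1).unpair.2 q.2) :=
    D1.forced (by fun_prop) (by fun_prop) (by fun_prop)
  have hD' : D1 (fun i => J (O i)) P fun i (q : α × ℕ) =>
      forced (O i) (τ q.1) (κ q.1).unpair.1 (Nat.pair (κ q.1).unpair.2 q.2) := S1.jump (hD _).1
  have hE : D1 (fun i => J (O i)) P fun i a => ∃ M : ℕ,
      forced (O i) (τ a) (κ a).unpair.1 (Nat.pair (κ a).unpair.2 M) := S1.jump (S1.ex (hD _).1)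
  have hm : S1 (fun i => J (O i)) P fun i (q : α × ℕ) => ∀ s < q.2,
      ¬ forced (O i) (τ q.1) (κ q.1).unpair.1 (Nat.pair (κ q.1).unpair.2 s) :=
    S1.ball (hD'.2.comp (g := fun q : (α × ℕ) × ℕ => (q.1.1, q.2)) (by fun_prop)) (by fun_prop)
  have hf : S1 (fun i => J (O i)) P fun i a => ∃ M : ℕ,
      forced (O i) (τ a) (κ a).unpair.1 (Nat.pair (κ a).unpair.2 M) ∧
      (∀ s < M, ¬ forced (O i) (τ a) (κ a).unpair.1 (Nat.pair (κ a).unpair.2 s)) ∧ M + 1 = z a :=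
    S1.ex (S1.and hD'.1 (S1.and hm (S1.prim (by fun_prop))))
  refine (hf.or (hE.2.and (S1.prim (p := fun a => 0 = z a) (by fun_prop)))).of_iff fun i a => ?_
  by_cases h : ∃ M, forced (O i) (τ a) (κ a).unpair.1 (Nat.pair (κ a).unpair.2 M)
  · rw [forcedWit, dif_pos h]
    constructor
    · intro h'
      exact Or.inl ⟨_, Nat.find_spec h, fun s => Nat.find_min h, h'⟩
    · rintro (⟨M, h1, h2, h3⟩ | h')
      · rw [(Nat.find_eq_iff h).2 ⟨h1, h2⟩, h3]
      · exact absurd h h'.1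
  · rw [forcedWit, dif_neg h]
    constructor
    · intro h'
      exact Or.inr ⟨h, h'⟩
    · rintro (⟨M, h1, _⟩ | h')
      · exact absurd ⟨M, h1⟩ h
      · exact h'.2

/-- The fact that machine `q` accepts a tuple ending in some `M`. -/
noncomputable def kq (b q l e n d : ℕ) (π : Str) : ℕ := kap b q n d (encode (b, l, e, n, d, π))

@[fun_prop] theorem primrec_kq {b q l e n d : α → ℕ} {π : α → Str} (hb : Primrec b)
    (hq : Primrec q) (hl : Primrec l) (he : Primrec e) (hn : Primrec n) (hd : Primrec d)
    (hπ : Primrec π) : Primrec fun a => kq (b a) (q a) (l a) (e a) (n a) (d a) (π a) := by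
  unfold kq; fun_prop

/-- The fact attacked at level `n`. -/
noncomputable def kz (b q n : ℕ) : ℕ :=
  kq b q (n - (n / 2).unpair.1) (n / 2).unpair.2 n ((n + 1) % 2) []

@[fun_prop] theorem primrec_kz {b q n : α → ℕ} (hb : Primrec b)
    (hq : Primrec q) (hn : Primrec n) : Primrec fun a => kz (b a) (q a) (n a) := by
  unfold kz; fun_prop

/-- The first block at level `n` on side `d`. -/
noncomputable def zf (A : ℕ → ℕ) (b q n d : ℕ) : ℕ :=
  if d = (n + 1) % 2 then Nat.pair (kz b q n) 0
  else Nat.pair 0 (forcedWit A (F A [Nat.pair (kz b q n) 0]) (kz b q n))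

theorem S1.zf_eq {b q n d z : α → ℕ} (hb : Primrec b) (hq : Primrec q) (hn : Primrec n)
    (hd : Primrec d) (hz : Primrec z) :
    S1 (fun i => J (O i)) P fun i a => zf (O i) (b a) (q a) (n a) (d a) = z a := by
  have h1 : S1 (fun i => J (O i)) P fun i (p : α × Str × ℕ) =>
      F (O i) [Nat.pair (kz (b p.1) (q p.1) (n p.1)) 0] = p.2.1 :=
    S1.F_eq (by fun_prop) (by fun_prop)
  have h2 : S1 (fun i => J (O i)) P fun i (p : α × Str × ℕ) =>
      forcedWit (O i) p.2.1 (kz (b p.1) (q p.1) (n p.1)) = p.2.2 :=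
    S1.forcedWit_eq (by fun_prop) (by fun_prop) (by fun_prop)
  have h3 : S1 (fun i => J (O i)) P fun i a => ∃ p : Str × ℕ,
      F (O i) [Nat.pair (kz (b a) (q a) (n a)) 0] = p.1 ∧
      forcedWit (O i) p.1 (kz (b a) (q a) (n a)) = p.2 ∧ ¬ d a = (n a + 1) % 2 ∧
      Nat.pair 0 p.2 = z a :=
    S1.ex (h1.and (h2.and (S1.prim (by fun_prop))))
  refine (h3.or (S1.prim (p := fun a => d a = (n a + 1) % 2 ∧
    Nat.pair (kz (b a) (q a) (n a)) 0 = z a) (by fun_prop))).of_iff fun i a => ?_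
  by_cases h : d a = (n a + 1) % 2
  · simp [zf, h]
  · simp [zf, h]

/-- The inductive step in the computation of the upper levels of one tower from those of the
other. -/
def Step (A X : ℕ → ℕ) (q b l e n d : ℕ) (π : Str) (M : ℕ) : Prop :=
  ∃ p : Str × Str, forcedFact A (F A (zseg (zf A b q n d)
      (initSeg X (kq b q l e n d p.1 + 1)))) (kq b q l e n d p.1) ∧
    F A p.2 <+: evens p.1 ∧ π ++ [M] <+: vals p.2

theorem S1.step {q b l e n d M : α → ℕ} {π : α → Str} (hq : Primrec q) (hb : Primrec b)
    (hl : Primrec l) (he : Primrec e) (hn : Primrec n) (hd : Primrec d) (hM : Primrec M)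
    (hπ : Primrec π) : S1 (fun i => J (O i)) P fun i a =>
      Step (O i) (P i) (q a) (b a) (l a) (e a) (n a) (d a) (π a) (M a) := by
  have h1 : S1 (fun i => J (O i)) P fun i (p : α × (Str × Str) × ℕ × Str × Str × Str) =>
      zf (O i) (b p.1) (q p.1) (n p.1) (d p.1) = p.2.2.1 :=
    S1.zf_eq (by fun_prop) (by fun_prop) (by fun_prop) (by fun_prop) (by fun_prop)
  have h2 : S1 (fun i => J (O i)) P fun i (p : α × (Str × Str) × ℕ × Str × Str × Str) =>
      initSeg (P i) (kq (b p.1) (q p.1) (l p.1) (e p.1) (n p.1) (d p.1) p.2.1.1 + 1) =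
        p.2.2.2.1 :=
    S1.initSeg_eq (by fun_prop) (by fun_prop)
  have h3 : S1 (fun i => J (O i)) P fun i (p : α × (Str × Str) × ℕ × Str × Str × Str) =>
      F (O i) (zseg p.2.2.1 p.2.2.2.1) = p.2.2.2.2.1 :=
    S1.F_eq (by fun_prop) (by fun_prop)
  have h4 : S1 (fun i => J (O i)) P fun i (p : α × (Str × Str) × ℕ × Str × Str × Str) =>
      F (O i) p.2.1.2 = p.2.2.2.2.2 :=
    S1.F_eq (by fun_prop) (by fun_prop)
  have h5 : S1 (fun i => J (O i)) P fun i (p : α × (Str × Str) × ℕ × Str × Str × Str) =>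
      forcedFact (O i) p.2.2.2.2.1
        (kq (b p.1) (q p.1) (l p.1) (e p.1) (n p.1) (d p.1) p.2.1.1) :=
    (D1.forcedFact (by fun_prop) (by fun_prop)).1
  have h6 : S1 (fun i => J (O i)) P fun _ (p : α × (Str × Str) × ℕ × Str × Str × Str) =>
      p.2.2.2.2.2 <+: evens p.2.1.1 ∧ π p.1 ++ [M p.1] <+: vals p.2.1.2 :=
    S1.prim (by fun_prop)
  have h7 := S1.ex (Φ := fun (i : ι) (a : α) (p : (Str × Str) × ℕ × Str × Str × Str) =>
      zf (O i) (b a) (q a) (n a) (d a) = p.2.1 ∧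
      initSeg (P i) (kq (b a) (q a) (l a) (e a) (n a) (d a) p.1.1 + 1) = p.2.2.1 ∧
      F (O i) (zseg p.2.1 p.2.2.1) = p.2.2.2.1 ∧ F (O i) p.1.2 = p.2.2.2.2 ∧
      forcedFact (O i) p.2.2.2.1 (kq (b a) (q a) (l a) (e a) (n a) (d a) p.1.1) ∧
      p.2.2.2.2 <+: evens p.1.1 ∧ π a ++ [M a] <+: vals p.1.2)
    (h1.and (h2.and (h3.and (h4.and (h5.and h6)))))
  refine h7.of_iff fun i a => ?_
  unfold Step
  generalize kq (b a) (q a) (l a) (e a) (n a) (d a) = κ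
  generalize zf (O i) (b a) (q a) (n a) (d a) = z
  constructor
  · rintro ⟨p, hp⟩
    exact ⟨(p, z, initSeg (P i) (κ p.1 + 1), F (O i) (zseg z (initSeg (P i) (κ p.1 + 1))),
      F (O i) p.2), rfl, rfl, rfl, rfl, hp⟩
  · rintro ⟨⟨p, z', ρ, τ, τ'⟩, hz, hρ, hτ, hτ', hp⟩
    dsimp only at hz hρ hτ hτ' hp
    subst hz hρ hτ hτ'
    exact ⟨p, hp⟩

theorem exists_eQ : ∃ q, (∀ B X (b e n d : ℕ) (π : Str) (M : ℕ),
      W B X q (encode ((b, 0, e, n, d, π), M)) ↔ W B X e (encode (π ++ [M]))) ∧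
    ∀ A X (b l e n d : ℕ) (π : Str) (M : ℕ), W (J A) X q (encode ((b, l + 1, e, n + 1, d, π), M)) ↔
      Step A X q b l e n d π M := by
  obtain ⟨Ψ, hΨ, H⟩ := (S1.step (ι := (ℕ → ℕ) × (ℕ → ℕ)) (O := Prod.fst) (P := Prod.snd)
    (α := ℕ × (ℕ × ℕ × ℕ × ℕ × ℕ × Str) × ℕ) (q := fun v => v.1) (b := fun v => v.2.1.1)
    (l := fun v => v.2.1.2.1 - 1) (e := fun v => v.2.1.2.2.1) (n := fun v => v.2.1.2.2.2.1 - 1)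
    (d := fun v => v.2.1.2.2.2.2.1) (π := fun v => v.2.1.2.2.2.2.2) (M := fun v => v.2.2)
    (by fun_prop) (by fun_prop) (by fun_prop) (by fun_prop) (by fun_prop) (by fun_prop)
    (by fun_prop) (by fun_prop)).extend
  have h0 : S1 (ι := (ℕ → ℕ) × (ℕ → ℕ)) Prod.fst Prod.snd
      fun i (v : ℕ × (ℕ × ℕ × ℕ × ℕ × ℕ × Str) × ℕ) => v.2.1.2.1 = 0 ∧
        W i.1 i.2 v.2.1.2.2.1 (encode (v.2.1.2.2.2.2.2 ++ [v.2.2])) :=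
    (S1.prim (by fun_prop)).and (S1.univ (by fun_prop) (by fun_prop))
  have h1 : S1 (ι := (ℕ → ℕ) × (ℕ → ℕ)) Prod.fst Prod.snd
      fun i (v : ℕ × (ℕ × ℕ × ℕ × ℕ × ℕ × Str) × ℕ) => v.2.1.2.1 ≠ 0 ∧ Ψ i v :=
    (S1.prim (by fun_prop)).and hΨ
  obtain ⟨q, hq⟩ := S1.fix (Θ := fun (i : (ℕ → ℕ) × (ℕ → ℕ)) (q : ℕ)
    (v : (ℕ × ℕ × ℕ × ℕ × ℕ × Str) × ℕ) => (v.1.2.1 = 0 ∧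
      W i.1 i.2 v.1.2.2.1 (encode (v.1.2.2.2.2.2 ++ [v.2]))) ∨ (v.1.2.1 ≠ 0 ∧ Ψ i (q, v)))
    (h0.or h1)
  refine ⟨q, fun B X b e n d π M => (hq (B, X) _).trans ?_,
    fun A X b l e n d π M => (hq (J A, X) _).trans ?_⟩
  · simp
  · simpa using (H (A, X) (q, (b, l + 1, e, n + 1, d, π), M)).symm

/-- An index for the computation of the levels of one tower from those of the other. -/
noncomputable def eQ : ℕ := exists_eQ.choose

theorem W_eQ_zero {B X : ℕ → ℕ} {b e n d : ℕ} {π : Str} {M : ℕ} :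
    W B X eQ (encode ((b, 0, e, n, d, π), M)) ↔ W B X e (encode (π ++ [M])) :=
  exists_eQ.choose_spec.1 ..

theorem W_eQ_succ {A X : ℕ → ℕ} {b l e n d : ℕ} {π : Str} {M : ℕ} :
    W (J A) X eQ (encode ((b, l + 1, e, n + 1, d, π), M)) ↔ Step A X eQ b l e n d π M :=
  exists_eQ.choose_spec.2 ..

/-- The string `σ` shows that `G` is not the image of a good point under the treemap. -/
def BadAt (A G : ℕ → ℕ) (b j n d : ℕ) (σ : Str) : Prop :=
  Seg (F A σ) G ∧ (¬ Seg (F A (σ ++ [G (F A σ).length])) G ∨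
    (σ ≠ [] ∧ σ.getD 0 0 ≠ zf A b eQ n d) ∨
    (∃ k < σ.length - 1, (σ.getD (k + 1) 0).unpair.1 ≠ k) ∨
    ∃ y : ℕ × ℕ, y.2 ≤ (vals σ).length ∧
      st (initSeg (J A) y.2) (vals σ) eBad (encode ((b, j, n + 1, d), y.1)) y.2)

theorem S1.badAt {b j n d : α → ℕ} {σ : α → Str} (hb : Primrec b) (hj : Primrec j)
    (hn : Primrec n) (hd : Primrec d) (hσ : Primrec σ) : S1 (fun i => J (O i)) P fun i a =>
      BadAt (O i) (P i) (b a) (j a) (n a) (d a) (σ a) := by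
  have hF : S1 (fun i => J (O i)) P fun i a => Seg (F (O i) (σ a)) (P i) := by
    have h1 : S1 (fun i => J (O i)) P fun i (p : α × Str) => F (O i) (σ p.1) = p.2 :=
      S1.F_eq (by fun_prop) (by fun_prop)
    have h2 : S1 (fun i => J (O i)) P fun i (p : α × Str) => Seg p.2 (P i) :=
      (D1.seg (by fun_prop)).1
    refine (S1.ex (Φ := fun (i : ι) (a : α) (p : Str) => F (O i) (σ a) = p ∧ Seg p (P i))
      (h1.and h2)).of_iff fun i a => ?_
    simp
  have hN : S1 (fun i => J (O i)) P fun i a =>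
      ¬ Seg (F (O i) (σ a ++ [P i (F (O i) (σ a)).length])) (P i) := by
    have h1 : S1 (fun i => J (O i)) P fun i (p : α × Str × ℕ × Str) =>
        F (O i) (σ p.1) = p.2.1 := S1.F_eq (by fun_prop) (by fun_prop)
    have h2 : S1 (fun i => J (O i)) P fun i (p : α × Str × ℕ × Str) =>
        P i p.2.1.length = p.2.2.1 := S1.query_right (by fun_prop) (by fun_prop)
    have h3 : S1 (fun i => J (O i)) P fun i (p : α × Str × ℕ × Str) =>
        F (O i) (σ p.1 ++ [p.2.2.1]) = p.2.2.2 := S1.F_eq (by fun_prop) (by fun_prop)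
    have h4 : S1 (fun i => J (O i)) P fun i (p : α × Str × ℕ × Str) =>
        ¬ Seg p.2.2.2 (P i) := (D1.seg (by fun_prop)).2
    have h5 := S1.ex (Φ := fun (i : ι) (a : α) (p : Str × ℕ × Str) =>
      F (O i) (σ a) = p.1 ∧ P i p.1.length = p.2.1 ∧ F (O i) (σ a ++ [p.2.1]) = p.2.2 ∧
        ¬ Seg p.2.2 (P i)) (h1.and (h2.and (h3.and h4)))
    refine h5.of_iff fun i a => ?_
    constructor
    · intro h
      exact ⟨(_, _, _), rfl, rfl, rfl, h⟩
    · rintro ⟨⟨ρ, m, τ⟩, hρ, hm, hτ, h⟩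
      dsimp only at hρ hm hτ h
      subst hρ hm hτ
      exact h
  have hZ : S1 (fun i => J (O i)) P fun i a =>
      σ a ≠ [] ∧ (σ a).getD 0 0 ≠ zf (O i) (b a) eQ (n a) (d a) := by
    have h1 : S1 (fun i => J (O i)) P fun i (p : α × ℕ) =>
        zf (O i) (b p.1) eQ (n p.1) (d p.1) = p.2 :=
      S1.zf_eq (by fun_prop) (by fun_prop) (by fun_prop) (by fun_prop) (by fun_prop)
    have h2 : S1 (fun i => J (O i)) P fun _ (p : α × ℕ) =>
        σ p.1 ≠ [] ∧ (σ p.1).getD 0 0 ≠ p.2 := S1.prim (by fun_prop)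
    refine (S1.ex (Φ := fun (i : ι) (a : α) (p : ℕ) => zf (O i) (b a) eQ (n a) (d a) = p ∧
      σ a ≠ [] ∧ (σ a).getD 0 0 ≠ p) (h1.and h2)).of_iff fun i a => ?_
    simp
  have hT : S1 (fun i => J (O i)) P fun _ a =>
      ∃ k < (σ a).length - 1, ((σ a).getD (k + 1) 0).unpair.1 ≠ k := S1.prim (by fun_prop)
  have hW : S1 (fun i => J (O i)) P fun i a => ∃ y : ℕ × ℕ, y.2 ≤ (vals (σ a)).length ∧
      st (initSeg (J (O i)) y.2) (vals (σ a)) eBad (encode ((b a, j a, n a + 1, d a), y.1)) y.2 := by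
    have h1 : S1 (fun i => J (O i)) P fun i (p : α × ℕ × ℕ) =>
        st (initSeg (J (O i)) p.2.2) (vals (σ p.1)) eBad
          (encode ((b p.1, j p.1, n p.1 + 1, d p.1), p.2.1)) p.2.2 :=
      S1.base (g := fun p : α × ℕ × ℕ => p.2.2) (p := fun r => st r.1.1 (vals (σ r.2.1)) eBad
        (encode ((b r.2.1, j r.2.1, n r.2.1 + 1, d r.2.1), r.2.2.1)) r.2.2.2)
        (by fun_prop) (by fun_prop)
    have h2 : S1 (fun i => J (O i)) P fun _ (p : α × ℕ × ℕ) => p.2.2 ≤ (vals (σ p.1)).length :=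
      S1.prim (by fun_prop)
    exact S1.ex (h2.and h1)
  exact hF.and (hN.or (hZ.or (hT.or hW)))

theorem exists_b0 : ∃ b, ∀ A G j n d (M : ℕ),
    W (J A) G b (encode ((j, n, d), M)) ↔ ∃ σ, BadAt A G b j n d σ := by
  have h1 : S1 (ι := (ℕ → ℕ) × (ℕ → ℕ)) (fun i => J i.1) Prod.snd
      fun i (p : (ℕ × (ℕ × ℕ × ℕ) × ℕ) × Str) =>
      BadAt i.1 i.2 p.1.1 p.1.2.1.1 p.1.2.1.2.1 p.1.2.1.2.2 p.2 :=
    S1.badAt (by fun_prop) (by fun_prop) (by fun_prop) (by fun_prop) (by fun_prop)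
  have h2 := S1.ex (Φ := fun (i : (ℕ → ℕ) × (ℕ → ℕ)) (p : ℕ × (ℕ × ℕ × ℕ) × ℕ) (σ : Str) =>
    BadAt i.1 i.2 p.1 p.2.1.1 p.2.1.2.1 p.2.1.2.2 σ) h1
  obtain ⟨b, hb⟩ := S1.fix (Θ := fun (i : (ℕ → ℕ) × (ℕ → ℕ)) (b : ℕ) (p : (ℕ × ℕ × ℕ) × ℕ) =>
    ∃ σ, BadAt i.1 i.2 b p.1.1 p.1.2.1 p.1.2.2 σ) h2
  exact ⟨b, fun A G j n d M => hb (A, G) ((j, n, d), M)⟩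

/-- The index of the machine recognizing that a point is not the image of a good point. -/
noncomputable def b0 : ℕ := exists_b0.choose

theorem W_b0 {A G : ℕ → ℕ} {j n d M : ℕ} :
    W (J A) G b0 (encode ((j, n, d), M)) ↔ ∃ σ, BadAt A G b0 j n d σ :=
  exists_b0.choose_spec A G j n d M

theorem not_badAt_iff {A G : ℕ → ℕ} {b j n d : ℕ} : (∀ σ, ¬ BadAt A G b j n d σ) ↔
    ∃ X, G = Fpath A (Zof (zf A b eQ n d) X) ∧
      ∀ x : ℕ, ¬ W (J A) X eBad (encode ((b, j, n + 1, d), x)) := by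
  constructor
  · intro H
    obtain ⟨Z, hZ, hseg⟩ := exists_Fpath_eq fun σ hσ => by
      by_contra h; exact H σ ⟨hσ, Or.inl h⟩
    have h0 : Z 0 = zf A b eQ n d := by
      by_contra h
      exact H (initSeg Z 1) ⟨hseg 1, Or.inr <| Or.inl ⟨by simp [initSeg],
        by rwa [getD_initSeg (by omega)]⟩⟩
    have h1 : ∀ k, (Z (k + 1)).unpair.1 = k := by
      intro k
      by_contra h
      exact H (initSeg Z (k + 2)) ⟨hseg _, Or.inr <| Or.inr <| Or.inl
        ⟨k, by simp, by rwa [getD_initSeg (by omega)]⟩⟩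
    have h2 : Z = Zof (zf A b eQ n d) fun k => (Z (k + 1)).unpair.2 := by
      funext k
      cases k with
      | zero => exact h0
      | succ k =>
        simp only [Zof]
        conv_rhs => rw [← h1 k]
        rw [h1 k]
        conv_lhs => rw [← Nat.pair_unpair (Z (k + 1)), h1 k]
    refine ⟨_, hZ.trans (congrArg _ h2), ?_⟩
    rintro x ⟨k, hk⟩
    have hv : vals (initSeg Z (k + 1)) = initSeg (fun k => (Z (k + 1)).unpair.2) k := by
      conv_lhs => rw [h2]
      rw [initSeg_Zof, vals_zseg]
    exact H (initSeg Z (k + 1)) ⟨hseg _, Or.inr <| Or.inr <| Or.inr ⟨(x, k), by simp [hv],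
      by rw [hv]; exact hk⟩⟩
  · rintro ⟨X, hG, hX⟩ σ ⟨hσ, h⟩
    set Z := Zof (zf A b eQ n d) X with hZ
    have hs : Seg σ Z := seg_of_seg_F (by rwa [← hG])
    rcases h with h | h | ⟨k, hk, h⟩ | ⟨y, hy, h⟩
    · have h1 := seg_F A Z (σ.length + 1)
      rw [initSeg_succ, ← hs, ← hG] at h1
      rw [← (seg_concat.1 (h1.mono_left (F_concat_mono A _ _))).2] at h1
      exact h h1
    · refine h.2 ?_
      rw [hs.getD (List.length_pos_iff.2 h.1)]; rfl
    · rw [hs.getD (by omega)] at h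
      simp [hZ, Zof] at h
    · refine hX y.1 ⟨y.2, ?_⟩
      have hv := Seg.vals hs
      rw [Seg] at hv
      rw [hv] at h
      exact (st_initSeg le_rfl hy).1 (by rwa [st_initSeg le_rfl hy] at h ⊢)

theorem forall_exists_psi_iff {A G : ℕ → ℕ} {j n d : ℕ} :
    (∀ x, ∃ t, psi b0 A G (j, n, d) x t) ↔ ∃ X, G = Fpath A (Zof (zf A b0 eQ n d) X) ∧
      ∀ x : ℕ, ¬ W (J A) X eBad (encode ((b0, j, n + 1, d), x)) := by
  rw [exists_psi_iff, ← not_badAt_iff]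
  simp only [W_b0]
  simp

end Recursion

section Towers

/-- The iterated jumps of the empty set. -/
noncomputable def AA : ℕ → ℕ → ℕ
  | 0 => zeroF
  | n + 1 => J (AA n)

/-- The generic part at level `n` of a tower with level `n + 1` equal to `X`. -/
noncomputable def gen (d n : ℕ) (X : ℕ → ℕ) : ℕ → ℕ :=
  Fpath (AA n) (Zof (zf (AA n) b0 eQ n d) X)

/-- The level `n` of a tower with level `n + 1` equal to `X`. -/
noncomputable def lower (d n : ℕ) (X : ℕ → ℕ) : ℕ → ℕ := mk b0 (AA n) (gen d n X) n d

theorem lower_congr {d n k : ℕ} {X X' : ℕ → ℕ} (h : ∀ i < k, X i = X' i) :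
    ∀ i < k + 1, lower d n X i = lower d n X' i :=
  mk_congr (Fpath_congr (Zof_congr h))

/-- Finite approximations to the levels of the tower. -/
noncomputable def approx (d : ℕ) : ℕ → ℕ → ℕ → ℕ
  | 0, _ => zeroF
  | k + 1, n => lower d n (approx d k (n + 1))

/-- The levels of the tower on side `d`. -/
noncomputable def tower (d n p : ℕ) : ℕ := approx d (p + 1) n p

theorem approx_succ (d : ℕ) : ∀ k n, ∀ p < k, approx d k n p = approx d (k + 1) n p := by
  intro k
  induction k with
  | zero => intro n p hp; omega
  | succ k ih => intro n; exact lower_congr (ih (n + 1))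

theorem approx_eq_tower (d n : ℕ) : ∀ k, ∀ p < k, approx d k n p = tower d n p := by
  intro k
  induction k with
  | zero => intro p hp; omega
  | succ k ih =>
    intro p hp
    rcases Nat.lt_succ_iff_lt_or_eq.1 hp with h | rfl
    · rw [← approx_succ d k n p h, ih p h]
    · rfl

theorem tower_eq (d n : ℕ) : tower d n = lower d n (tower d (n + 1)) := by
  funext p
  exact lower_congr (approx_eq_tower d (n + 1) p) p (Nat.lt_succ_self p)

theorem eq_tower {d : ℕ} {Y : ℕ → ℕ → ℕ} (h : ∀ n, Y n = lower d n (Y (n + 1))) :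
    ∀ n, Y n = tower d n := by
  have : ∀ k n, ∀ p < k, Y n p = tower d n p := by
    intro k
    induction k with
    | zero => intro n p hp; omega
    | succ k ih =>
      intro n
      rw [h n, tower_eq d n]
      exact lower_congr (ih (n + 1))
  intro n
  funext p
  exact this (p + 1) n p (Nat.lt_succ_self p)

/-- The generic part of the tower at level `n`. -/
noncomputable def tgen (d n : ℕ) : ℕ → ℕ := gen d n (tower d (n + 1))

theorem tower_eq_mk (d n : ℕ) : tower d n = mk b0 (AA n) (tgen d n) n d := tower_eq d n

theorem not_bad_of_psi {d n j x : ℕ} (h : ∃ t, psi b0 (AA n) (tgen d n) (j, n, d) x t) :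
    ¬ Bad (AA n) (tower d n) (b0, j + 1, n, d) x := by
  rintro ⟨-, hb⟩
  refine hb ?_
  rw [tower_eq_mk d n, evenF_mk]
  simp only [Nat.add_sub_cancel, mk_odd]
  exact (wit_eq_iff h).1 rfl

theorem good_tgen (d n : ℕ) : Good b0 (AA n) (tgen d n) n d := by
  intro j
  induction j generalizing n with
  | zero =>
    refine forall_exists_psi_iff.2 ⟨_, rfl, fun x => ?_⟩
    rw [W_eBad]
    exact fun h => h.1 rfl
  | succ j ih =>
    refine forall_exists_psi_iff.2 ⟨_, rfl, fun x => ?_⟩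
    rw [W_eBad]
    exact not_bad_of_psi (ih (n + 1) x)

theorem not_bad_tower (d n j x : ℕ) : ¬ Bad (AA n) (tower d n) (b0, j, n, d) x := by
  cases j with
  | zero => exact fun h => h.1 rfl
  | succ j => exact not_bad_of_psi (good_tgen d n j x)

theorem exists_eq_lower {d n : ℕ} {X : ℕ → ℕ}
    (h : ∀ j x, ¬ Bad (AA n) X (b0, j, n, d) x) :
    ∃ X', (∀ j x, ¬ Bad (AA (n + 1)) X' (b0, j, n + 1, d) x) ∧ X = lower d n X' := by
  have hw : ∀ j x, IsWit b0 (AA n) (evenF X) (j, n, d) x (X (2 * Nat.pair j x + 1)) := by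
    intro j x
    by_contra hb
    exact h (j + 1) x ⟨Nat.succ_ne_zero j, hb⟩
  have hp : ∀ j, ∃ X', evenF X = gen d n X' ∧
      ∀ x : ℕ, ¬ W (AA (n + 1)) X' eBad (encode ((b0, j, n + 1, d), x)) :=
    fun j => forall_exists_psi_iff.1 fun x => ⟨_, (hw j x).1⟩
  choose Y hY hYb using hp
  have hYeq : ∀ j, Y j = Y 0 := fun j =>
    Zof_injective (Fpath_injective ((hY j).symm.trans (hY 0)))
  refine ⟨Y 0, fun j x => ?_, ?_⟩
  · rw [← W_eBad, ← hYeq j]; exact hYb j x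
  · funext p
    rw [lower, ← hY 0, mk]
    split_ifs with hpar
    · rw [evenF]; congr 1; omega
    · have := hw (p / 2).unpair.1 (p / 2).unpair.2
      rw [(wit_eq_iff ⟨_, this.1⟩).2 this, Nat.pair_unpair]
      congr 1; omega

theorem eq_tower_zero_iff {d : ℕ} {X : ℕ → ℕ} :
    X = tower d 0 ↔ ∀ j x, ¬ Bad zeroF X (b0, j, 0, d) x := by
  constructor
  · rintro rfl j x
    exact not_bad_tower d 0 j x
  · intro h
    let S : ℕ → Type := fun n => {X : ℕ → ℕ // ∀ j x, ¬ Bad (AA n) X (b0, j, n, d) x}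
    let Y : ∀ n, S n := fun n =>
      n.rec ⟨X, h⟩ fun _ Z => ⟨(exists_eq_lower Z.2).choose, (exists_eq_lower Z.2).choose_spec.1⟩
    exact eq_tower (Y := fun n => (Y n).1) (fun n => (exists_eq_lower (Y n).2).choose_spec.2) 0

end Towers

section Effective

/-- Codes without oracle as oracle codes. -/
def toOCode : Code → OCode
  | .zero => .zero
  | .succ => .succ
  | .left => .left
  | .right => .right
  | .pair f g => .pair (toOCode f) (toOCode g)
  | .comp f g => .comp (toOCode f) (toOCode g)
  | .prec f g => .prec (toOCode f) (toOCode g)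
  | .rfind' f => .rfind' (toOCode f)

theorem evalo_toOCode (A : ℕ → ℕ) (c : Code) : evalo A (toOCode c) = Code.eval c := by
  induction c with
  | zero => rfl
  | succ => rfl
  | left => rfl
  | right => rfl
  | pair f g hf hg => simp only [toOCode, evalo, Code.eval, hf, hg]; rfl
  | comp f g hf hg => simp only [toOCode, evalo, Code.eval, hf, hg]; rfl
  | prec f g hf hg => simp only [toOCode, evalo, Code.eval, hf, hg]; rfl
  | rfind' f hf => simp only [toOCode, evalo, Code.eval, hf]; rfl

theorem setRecIn_of_primrecPred {A : ℕ → ℕ} {T : Set Str} (hT : PrimrecPred fun σ => σ ∈ T) :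
    SetRecIn A T := by
  have h : Primrec (chi T) := by unfold chi; fun_prop
  obtain ⟨c, hc⟩ := Code.exists_code.1 h.to_comp.partrec
  refine ⟨toOCode c, fun σ => ?_⟩
  rw [evalo_toOCode, hc]
  simp

theorem S1.isPi01 {Φ : (ℕ → ℕ) → Unit → Prop} (h : S1 (fun _ => zeroF) id Φ) :
    IsPi01 {X | ¬ Φ X ()} := by
  obtain ⟨p, hp, h⟩ := h
  have h0 : Primrec (initSeg zeroF) := by unfold initSeg zeroF; fun_prop
  refine ⟨{σ | ∀ s < σ.length + 1, ¬ p ((initSeg zeroF s, σ.take s), ((), s))}, ?_, ?_, ?_⟩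
  · rintro σ _ ⟨ρ, rfl⟩ hτ s hs
    have := hτ s (by simp; omega)
    rwa [List.take_append_of_le_length (by omega)] at this
  · refine setRecIn_of_primrecPred ?_
    simp only [Set.mem_ofPred_eq]
    fun_prop
  · ext X
    simp only [Set.mem_ofPred_eq, paths, h, length_initSeg, take_initSeg, not_exists, id]
    constructor
    · intro H n s hs
      rw [min_eq_left (by omega)]
      exact H s
    · intro H s
      have := H s s (Nat.lt_succ_self s)
      rwa [min_self] at this

theorem isPi01_tower (d : ℕ) : IsPi01 {tower d 0} := by
  have h1 : S1 (fun _ => zeroF) id fun X (q : Unit × ℕ × ℕ) =>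
      Bad zeroF X (b0, q.2.1, 0, d) q.2.2 :=
    S1.bad.comp (g := fun q : Unit × ℕ × ℕ => ((b0, q.2.1, 0, d), q.2.2)) (by fun_prop)
  have h2 := S1.ex (Φ := fun (X : ℕ → ℕ) (_ : Unit) (q : ℕ × ℕ) =>
    Bad zeroF X (b0, q.1, 0, d) q.2) h1
  convert h2.isPi01 using 1
  ext X
  simp only [Set.mem_singleton_iff, eq_tower_zero_iff, Set.mem_ofPred_eq, Prod.exists, not_exists]

end Effective

section Evaluation

theorem exists_ofNat_eq (c : OCode) : ∃ e, OCode.ofNat e = c := by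
  have key (b b' : Bool) (m : ℕ) : (Nat.bit b (Nat.bit b' m)).bodd = b ∧
      (Nat.bit b (Nat.bit b' m)).div2.bodd = b' ∧ (Nat.bit b (Nat.bit b' m)).div2.div2 = m := by
    simp
  induction c with
  | zero => exact ⟨0, by rw [OCode.ofNat]⟩
  | succ => exact ⟨1, by rw [OCode.ofNat]⟩
  | left => exact ⟨2, by rw [OCode.ofNat]⟩
  | right => exact ⟨3, by rw [OCode.ofNat]⟩
  | oracle => exact ⟨4, by rw [OCode.ofNat]⟩
  | pair f g hf hg =>
    obtain ⟨a, rfl⟩ := hf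
    obtain ⟨b, rfl⟩ := hg
    obtain ⟨h1, h2, h3⟩ := key false false (Nat.pair a b)
    exact ⟨Nat.bit false (Nat.bit false (Nat.pair a b)) + 5, by
      rw [OCode.ofNat]; simp only [h1, h2, h3, Nat.unpair_pair]⟩
  | comp f g hf hg =>
    obtain ⟨a, rfl⟩ := hf
    obtain ⟨b, rfl⟩ := hg
    obtain ⟨h1, h2, h3⟩ := key false true (Nat.pair a b)
    exact ⟨Nat.bit false (Nat.bit true (Nat.pair a b)) + 5, by
      rw [OCode.ofNat]; simp only [h1, h2, h3, Nat.unpair_pair]⟩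
  | prec f g hf hg =>
    obtain ⟨a, rfl⟩ := hf
    obtain ⟨b, rfl⟩ := hg
    obtain ⟨h1, h2, h3⟩ := key true false (Nat.pair a b)
    exact ⟨Nat.bit true (Nat.bit false (Nat.pair a b)) + 5, by
      rw [OCode.ofNat]; simp only [h1, h2, h3, Nat.unpair_pair]⟩
  | rfind' f hf =>
    obtain ⟨a, rfl⟩ := hf
    obtain ⟨h1, h2, h3⟩ := key true true a
    exact ⟨Nat.bit true (Nat.bit true a) + 5, by
      rw [OCode.ofNat]; simp only [h1, h2, h3]⟩

/-- The code of the immediate subcodes of the composite machine `e`. -/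
def subcode (e : ℕ) : ℕ := (e - 5).div2.div2

/-- One step in the evaluation of machine `e` on `x`, where `R` is the graph of the evaluation. -/
def EvStep (A : ℕ → ℕ) (R : ℕ → ℕ → ℕ → Prop) (e x y : ℕ) : Prop :=
  (e = 0 ∧ y = 0) ∨ (e = 1 ∧ y = x + 1) ∨ (e = 2 ∧ y = x.unpair.1) ∨ (e = 3 ∧ y = x.unpair.2) ∨
  (e = 4 ∧ A x = y) ∨
  ((5 ≤ e ∧ (e - 5).bodd = false ∧ (e - 5).div2.bodd = false) ∧ ∃ u : ℕ × ℕ,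
    R (subcode e).unpair.1 x u.1 ∧ R (subcode e).unpair.2 x u.2 ∧ y = Nat.pair u.1 u.2) ∨
  ((5 ≤ e ∧ (e - 5).bodd = false ∧ (e - 5).div2.bodd = true) ∧ ∃ u : ℕ,
    R (subcode e).unpair.2 x u ∧ R (subcode e).unpair.1 u y) ∨
  ((5 ≤ e ∧ (e - 5).bodd = true ∧ (e - 5).div2.bodd = false) ∧
    ((x.unpair.2 = 0 ∧ R (subcode e).unpair.1 x.unpair.1 y) ∨ (x.unpair.2 ≠ 0 ∧ ∃ u : ℕ,
      R e (Nat.pair x.unpair.1 (x.unpair.2 - 1)) u ∧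
      R (subcode e).unpair.2 (Nat.pair x.unpair.1 (Nat.pair (x.unpair.2 - 1) u)) y))) ∨
  ((5 ≤ e ∧ (e - 5).bodd = true ∧ (e - 5).div2.bodd = true) ∧ ∃ n : ℕ, y = n + x.unpair.2 ∧
    R (subcode e) (Nat.pair x.unpair.1 (n + x.unpair.2)) 0 ∧
    ∀ k < n, ∃ v : ℕ, v ≠ 0 ∧ R (subcode e) (Nat.pair x.unpair.1 (k + x.unpair.2)) v)

theorem subcode_lt {e : ℕ} (h : 5 ≤ e) : subcode e < e := by
  have h1 : (e - 5) / 2 / 2 ≤ e - 5 := (Nat.div_le_self _ _).trans (Nat.div_le_self _ _)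
  rw [subcode, Nat.div2_val, Nat.div2_val]; omega

theorem graph_of_evStep {A : ℕ → ℕ} {R : ℕ → ℕ → ℕ → Prop}
    (hR : ∀ e x y, R e x y ↔ EvStep A R e x y) (e : ℕ) :
    ∀ x y, R e x y ↔ y ∈ evalo A (OCode.ofNat e) x := by
  induction e using Nat.strong_induction_on with
  | _ e ih =>
  intro x y
  match e, ih with
  | 0, _ => rw [hR]; simp [EvStep, OCode.ofNat, evalo]; exact Part.mem_some_iff.symm
  | 1, _ => rw [hR]; simp [EvStep, OCode.ofNat, evalo]
  | 2, _ => rw [hR]; simp [EvStep, OCode.ofNat, evalo]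
  | 3, _ => rw [hR]; simp [EvStep, OCode.ofNat, evalo]
  | 4, _ => rw [hR]; simp [EvStep, OCode.ofNat, evalo, eq_comm]
  | n + 5, ih =>
    have hs := subcode_lt (e := n + 5) (by omega)
    have h1 := ih _ ((Nat.unpair_left_le _).trans_lt hs)
    have h2 := ih _ ((Nat.unpair_right_le _).trans_lt hs)
    have h3 := ih _ hs
    have hsub : subcode (n + 5) = n.div2.div2 := rfl
    rw [OCode.ofNat]
    rw [hsub] at h1 h2 h3
    rcases hb : n.bodd <;> rcases hb' : n.div2.bodd
    · rw [hR]
      simp [EvStep, hb, hb', hsub, h1, h2, evalo, Seq.seq]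
      constructor
      · rintro ⟨u, hu, v, hv, rfl⟩
        exact ⟨u, hu, v, hv, rfl⟩
      · rintro ⟨u, hu, v, hv, rfl⟩
        exact ⟨u, hu, v, hv, rfl⟩
    · rw [hR]
      simp [EvStep, hb, hb', hsub, h1, h2, evalo]
      exact Part.mem_bind_iff.symm
    · obtain ⟨a, k, rfl⟩ : ∃ a k, x = Nat.pair a k := ⟨_, _, (Nat.pair_unpair x).symm⟩
      induction k generalizing y with
      | zero =>
        rw [hR]
        simp [EvStep, hb, hb', hsub, h1, h2, evalo]
      | succ k ihk =>
        rw [hR]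
        simp only [EvStep, hb, hb', hsub, h1, h2, evalo, Nat.add_sub_cancel, Nat.unpair_pair, ihk]
        simp
    · rw [hR]
      have hm (k : ℕ) : k ∈ (Nat.rfind fun m => Part.map (fun v => decide (v = 0))
          (evalo A (OCode.ofNat n.div2.div2) (Nat.pair x.unpair.1 (m + x.unpair.2)))) ↔
          0 ∈ evalo A (OCode.ofNat n.div2.div2) (Nat.pair x.unpair.1 (k + x.unpair.2)) ∧
          ∀ m < k, ∃ v : ℕ, v ≠ 0 ∧
            v ∈ evalo A (OCode.ofNat n.div2.div2) (Nat.pair x.unpair.1 (m + x.unpair.2)) := by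
        refine Nat.mem_rfind.trans (and_congr ?_ (forall₂_congr fun m _ => ?_))
        · refine (Part.mem_map_iff _).trans ?_
          simp
        · refine (Part.mem_map_iff _).trans (exists_congr fun v => ?_)
          simp only [decide_eq_false_iff_not]
          exact and_comm
      simp only [EvStep, hb, hb', hsub, h3, Nat.add_sub_cancel]
      simp only [evalo, Nat.unpaired, Part.mem_map_iff, Part.map_eq_map, hm]
      simp only [Nat.reduceEqDiff, reduceCtorEq, false_and, and_false, false_or, le_add_iff_nonneg_left,
        zero_le, true_and]
      simp [and_comm, eq_comm]

variable {α : Type*} [Primcodable α] {ι : Type*} {O P : ι → ℕ → ℕ}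

@[fun_prop] theorem primrec_subcode {f : α → ℕ} (hf : Primrec f) : Primrec fun a => subcode (f a) := by
  unfold subcode; fun_prop

theorem S1.evStep : S1 O P fun i (q : ℕ × ℕ × ℕ × ℕ) => EvStep (P i)
    (fun e x y => W (O i) (P i) q.1 (encode (e, x, y))) q.2.1 q.2.2.1 q.2.2.2 := by
  have hpair : S1 O P fun i (q : (ℕ × ℕ × ℕ × ℕ) × (ℕ × ℕ)) =>
      W (O i) (P i) q.1.1 (encode ((subcode q.1.2.1).unpair.1, q.1.2.2.1, q.2.1)) ∧
      W (O i) (P i) q.1.1 (encode ((subcode q.1.2.1).unpair.2, q.1.2.2.1, q.2.2)) ∧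
      q.1.2.2.2 = Nat.pair q.2.1 q.2.2 :=
    (S1.univ (by fun_prop) (by fun_prop)).and
      ((S1.univ (by fun_prop) (by fun_prop)).and (S1.prim (by fun_prop)))
  have hcomp : S1 O P fun i (q : (ℕ × ℕ × ℕ × ℕ) × ℕ) =>
      W (O i) (P i) q.1.1 (encode ((subcode q.1.2.1).unpair.2, q.1.2.2.1, q.2)) ∧
      W (O i) (P i) q.1.1 (encode ((subcode q.1.2.1).unpair.1, q.2, q.1.2.2.2)) :=
    (S1.univ (by fun_prop) (by fun_prop)).and (S1.univ (by fun_prop) (by fun_prop))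
  have hprec : S1 O P fun i (q : (ℕ × ℕ × ℕ × ℕ) × ℕ) =>
      W (O i) (P i) q.1.1 (encode (q.1.2.1,
        Nat.pair q.1.2.2.1.unpair.1 (q.1.2.2.1.unpair.2 - 1), q.2)) ∧
      W (O i) (P i) q.1.1 (encode ((subcode q.1.2.1).unpair.2, Nat.pair q.1.2.2.1.unpair.1
        (Nat.pair (q.1.2.2.1.unpair.2 - 1) q.2), q.1.2.2.2)) :=
    (S1.univ (by fun_prop) (by fun_prop)).and (S1.univ (by fun_prop) (by fun_prop))
  have hfind : S1 O P fun i (q : (((ℕ × ℕ × ℕ × ℕ) × ℕ) × ℕ) × ℕ) => q.2 ≠ 0 ∧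
      W (O i) (P i) q.1.1.1.1 (encode (subcode q.1.1.1.2.1,
        Nat.pair q.1.1.1.2.2.1.unpair.1 (q.1.2 + q.1.1.1.2.2.1.unpair.2), q.2)) :=
    (S1.prim (by fun_prop)).and (S1.univ (by fun_prop) (by fun_prop))
  have hball := S1.ball (Φ := fun i (q : (ℕ × ℕ × ℕ × ℕ) × ℕ) k => ∃ v : ℕ, v ≠ 0 ∧
      W (O i) (P i) q.1.1 (encode (subcode q.1.2.1,
        Nat.pair q.1.2.2.1.unpair.1 (k + q.1.2.2.1.unpair.2), v)))
    (S1.ex (Φ := fun i (q : ((ℕ × ℕ × ℕ × ℕ) × ℕ) × ℕ) v => v ≠ 0 ∧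
      W (O i) (P i) q.1.1.1 (encode (subcode q.1.1.2.1,
        Nat.pair q.1.1.2.2.1.unpair.1 (q.2 + q.1.1.2.2.1.unpair.2), v))) hfind)
    (g := fun q => q.2) (by fun_prop)
  have hrf : S1 O P fun i (q : (ℕ × ℕ × ℕ × ℕ) × ℕ) =>
      q.1.2.2.2 = q.2 + q.1.2.2.1.unpair.2 ∧ W (O i) (P i) q.1.1 (encode (subcode q.1.2.1,
        Nat.pair q.1.2.2.1.unpair.1 (q.2 + q.1.2.2.1.unpair.2), 0)) :=
    (S1.prim (by fun_prop)).and (S1.univ (by fun_prop) (by fun_prop))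
  have hprec0 : S1 O P fun i (q : ℕ × ℕ × ℕ × ℕ) => q.2.2.1.unpair.2 = 0 ∧
      W (O i) (P i) q.1 (encode ((subcode q.2.1).unpair.1, q.2.2.1.unpair.1, q.2.2.2)) :=
    (S1.prim (by fun_prop)).and (S1.univ (by fun_prop) (by fun_prop))
  have h0 : S1 O P fun _ (q : ℕ × ℕ × ℕ × ℕ) => q.2.1 = 0 ∧ q.2.2.2 = 0 := S1.prim (by fun_prop)
  have h1 : S1 O P fun _ (q : ℕ × ℕ × ℕ × ℕ) => q.2.1 = 1 ∧ q.2.2.2 = q.2.2.1 + 1 :=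
    S1.prim (by fun_prop)
  have h2 : S1 O P fun _ (q : ℕ × ℕ × ℕ × ℕ) => q.2.1 = 2 ∧ q.2.2.2 = q.2.2.1.unpair.1 :=
    S1.prim (by fun_prop)
  have h3 : S1 O P fun _ (q : ℕ × ℕ × ℕ × ℕ) => q.2.1 = 3 ∧ q.2.2.2 = q.2.2.1.unpair.2 :=
    S1.prim (by fun_prop)
  have h4 : S1 O P fun i (q : ℕ × ℕ × ℕ × ℕ) => q.2.1 = 4 ∧ P i q.2.2.1 = q.2.2.2 :=
    (S1.prim (by fun_prop)).and (S1.query_right (by fun_prop) (by fun_prop))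
  have hc (b b' : Bool) : S1 O P fun _ (q : ℕ × ℕ × ℕ × ℕ) =>
      5 ≤ q.2.1 ∧ (q.2.1 - 5).bodd = b ∧ (q.2.1 - 5).div2.bodd = b' := S1.prim (by fun_prop)
  have hn : S1 O P fun _ (q : ℕ × ℕ × ℕ × ℕ) => q.2.2.1.unpair.2 ≠ 0 := S1.prim (by fun_prop)
  have e1 := S1.ex (Φ := fun i (q : ℕ × ℕ × ℕ × ℕ) (u : ℕ × ℕ) =>
      W (O i) (P i) q.1 (encode ((subcode q.2.1).unpair.1, q.2.2.1, u.1)) ∧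
      W (O i) (P i) q.1 (encode ((subcode q.2.1).unpair.2, q.2.2.1, u.2)) ∧
      q.2.2.2 = Nat.pair u.1 u.2) hpair
  have e2 := S1.ex (Φ := fun i (q : ℕ × ℕ × ℕ × ℕ) (u : ℕ) =>
      W (O i) (P i) q.1 (encode ((subcode q.2.1).unpair.2, q.2.2.1, u)) ∧
      W (O i) (P i) q.1 (encode ((subcode q.2.1).unpair.1, u, q.2.2.2))) hcomp
  have e3 := S1.ex (Φ := fun i (q : ℕ × ℕ × ℕ × ℕ) (u : ℕ) =>
      W (O i) (P i) q.1 (encode (q.2.1,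
        Nat.pair q.2.2.1.unpair.1 (q.2.2.1.unpair.2 - 1), u)) ∧
      W (O i) (P i) q.1 (encode ((subcode q.2.1).unpair.2, Nat.pair q.2.2.1.unpair.1
        (Nat.pair (q.2.2.1.unpair.2 - 1) u), q.2.2.2))) hprec
  have e4 := S1.ex (Φ := fun i (q : ℕ × ℕ × ℕ × ℕ) (n : ℕ) =>
      (q.2.2.2 = n + q.2.2.1.unpair.2 ∧ W (O i) (P i) q.1 (encode (subcode q.2.1,
        Nat.pair q.2.2.1.unpair.1 (n + q.2.2.1.unpair.2), 0))) ∧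
      ∀ k < n, ∃ v : ℕ, v ≠ 0 ∧ W (O i) (P i) q.1 (encode (subcode q.2.1,
        Nat.pair q.2.2.1.unpair.1 (k + q.2.2.1.unpair.2), v))) (hrf.and hball)
  refine (h0.or (h1.or (h2.or (h3.or (h4.or (((hc false false).and e1).or
    (((hc false true).and e2).or (((hc true false).and (hprec0.or (hn.and e3))).or
    ((hc true true).and e4))))))))).of_iff fun i q => ?_
  obtain ⟨c, e, x, y⟩ := q
  simp only [EvStep, and_assoc]

theorem S1.evalo {e x y : α → ℕ} (he : Primrec e) (hx : Primrec x) (hy : Primrec y) :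
    S1 O P fun i a => y a ∈ evalo (P i) (OCode.ofNat (e a)) (x a) := by
  obtain ⟨c, hc⟩ := S1.fix (α := ℕ × ℕ × ℕ) (Θ := fun i c q => EvStep (P i)
    (fun e x y => W (O i) (P i) c (encode (e, x, y))) q.1 q.2.1 q.2.2) (S1.evStep (O := O) (P := P))
  refine (S1.univ (e := fun _ => c) (x := fun a => encode (e a, x a, y a)) (by fun_prop)
    (by fun_prop)).of_iff fun i a => ?_
  exact (graph_of_evStep (R := fun e x y => W (O i) (P i) c (encode (e, x, y)))
    (fun e x y => hc i (e, x, y)) (e a) (x a) (y a)).symm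

end Evaluation

section Incomparability

theorem evenF_tower (d n : ℕ) : evenF (tower d n) = tgen d n := by
  rw [tower_eq_mk, evenF_mk]

theorem fact_tgen_iff {d n κ : ℕ} : fact (AA n) (tgen d n) κ ↔ forcedFact (AA n) (F (AA n)
    (zseg (zf (AA n) b0 eQ n d) (initSeg (tower d (n + 1)) (κ + 1)))) κ := by
  rw [tgen, gen, fact_Fpath_iff (k := κ + 1) (by simp [Zof]), initSeg_Zof]

theorem fact_tgen_kap_iff {d n e a : ℕ} :
    fact (AA n) (tgen d n) (kap b0 e n d a) ↔ ∃ M, W (AA n) (tower d n) e (Nat.pair a M) := by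
  rw [fact_kap (good_tgen d n), ← tower_eq_mk]

theorem seg_tower_succ {d n : ℕ} {π : Str} : Seg π (tower d (n + 1)) ↔ ∃ p : Str × Str,
    Seg p.1 (tower d n) ∧ F (AA n) p.2 <+: evens p.1 ∧ π <+: vals p.2 := by
  have hG : evenF (tower d n) = Fpath (AA n) (Zof (zf (AA n) b0 eQ n d) (tower d (n + 1))) :=
    evenF_tower d n
  constructor
  · intro h
    set σ := initSeg (Zof (zf (AA n) b0 eQ n d) (tower d (n + 1))) (π.length + 1) with hσ
    refine ⟨(initSeg (tower d n) (2 * (F (AA n) σ).length), σ), seg_initSeg _ _, ?_, ?_⟩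
    · rw [evens_initSeg, hG, hσ, ← F_eq_initSeg]
    · rw [hσ, initSeg_Zof, vals_zseg, ← h]
  · rintro ⟨⟨ρ, σ⟩, h1, h2, h3⟩
    have h4 := h1.evens.mono_left h2
    rw [hG] at h4
    exact (seg_of_seg_F h4).vals.mono_left h3

theorem step_tower_iff {d D n l e : ℕ} {π : Str} {M : ℕ}
    (H : ∀ (ρ : Str) (N : ℕ), W (AA n) (tower d n) eQ (encode ((b0, l, e, n, d, ρ), N)) ↔
      Seg (ρ ++ [N]) (tower D n)) :
    Step (AA n) (tower d (n + 1)) eQ b0 l e n d π M ↔ Seg (π ++ [M]) (tower D (n + 1)) := by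
  have key (ρ : Str) : forcedFact (AA n) (F (AA n) (zseg (zf (AA n) b0 eQ n d)
      (initSeg (tower d (n + 1)) (kq b0 eQ l e n d ρ + 1)))) (kq b0 eQ l e n d ρ) ↔
      Seg ρ (tower D n) := by
    rw [← fact_tgen_iff, kq, fact_tgen_kap_iff]
    have h1 (N : ℕ) : Nat.pair (encode (b0, l, e, n, d, ρ)) N =
      encode ((b0, l, e, n, d, ρ), N) := rfl
    simp only [h1, H, seg_concat]
    exact ⟨fun ⟨_, h, _⟩ => h, fun h => ⟨_, h, rfl⟩⟩
  rw [Step, seg_tower_succ]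
  exact exists_congr fun p => and_congr_left' (key p.1)

theorem W_eQ_tower_iff {d D m e : ℕ}
    (he : ∀ π : Str, W (AA m) (tower d m) e (encode π) ↔ Seg π (tower D m)) (l : ℕ) :
    ∀ (π : Str) (M : ℕ), W (AA (m + l)) (tower d (m + l)) eQ
      (encode ((b0, l, e, m + l, d, π), M)) ↔ Seg (π ++ [M]) (tower D (m + l)) := by
  induction l with
  | zero => intro π M; exact W_eQ_zero.trans (he _)
  | succ l ih => intro π M; exact W_eQ_succ.trans (step_tower_iff ih)

variable {α : Type*} [Primcodable α] {P : Unit → ℕ → ℕ}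

theorem S1.tower_succ {d n : ℕ} {Φ : α → Prop}
    (h : S1 (fun _ : Unit => AA n) (fun _ => tower d n) fun _ => Φ) :
    D1 (fun _ : Unit => AA (n + 1)) (fun _ => tower d (n + 1)) fun _ => Φ := by
  have h0 : S1 (fun _ : Unit => AA n) (fun _ => tower d n) fun _ (q : α × ℕ) => Φ q.1 :=
    h.comp (by fun_prop)
  obtain ⟨e, he⟩ := h0.index
  have hΦ (a : α) : Φ a ↔ forcedFact (AA n) (F (AA n) (zseg (zf (AA n) b0 eQ n d)
      (initSeg (tower d (n + 1)) (kap b0 e n d (encode a) + 1)))) (kap b0 e n d (encode a)) := by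
    rw [← fact_tgen_iff, fact_tgen_kap_iff]
    have h1 (N : ℕ) : Nat.pair (encode a) N = encode (a, N) := rfl
    simp only [h1, he () _]
    simp
  have h2 : D1 (fun _ : Unit => AA (n + 1)) (fun _ => tower d (n + 1))
      fun _ (q : α × Str × Str) => forcedFact (AA n) q.2.2 (kap b0 e n d (encode q.1)) :=
    D1.forcedFact (ι := Unit) (O := fun _ => AA n) (by fun_prop) (by fun_prop)
  have h3 : S1 (fun _ : Unit => AA (n + 1)) (fun _ => tower d (n + 1))
      fun _ (q : α × Str × Str) =>
        initSeg (tower d (n + 1)) (kap b0 e n d (encode q.1) + 1) = q.2.1 :=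
    S1.initSeg_eq (by fun_prop) (by fun_prop)
  have h4 : S1 (fun _ : Unit => AA (n + 1)) (fun _ => tower d (n + 1))
      fun _ (q : α × Str × Str) => F (AA n) (zseg (zf (AA n) b0 eQ n d) q.2.1) = q.2.2 :=
    S1.F_eq (ι := Unit) (O := fun _ => AA n) (by fun_prop) (by fun_prop)
  have h5 := S1.ex (Φ := fun (_ : Unit) (a : α) (q : Str × Str) =>
    initSeg (tower d (n + 1)) (kap b0 e n d (encode a) + 1) = q.1 ∧
    F (AA n) (zseg (zf (AA n) b0 eQ n d) q.1) = q.2 ∧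
    forcedFact (AA n) q.2 (kap b0 e n d (encode a))) (h3.and (h4.and h2.1))
  have h6 := S1.ex (Φ := fun (_ : Unit) (a : α) (q : Str × Str) =>
    initSeg (tower d (n + 1)) (kap b0 e n d (encode a) + 1) = q.1 ∧
    F (AA n) (zseg (zf (AA n) b0 eQ n d) q.1) = q.2 ∧
    ¬ forcedFact (AA n) q.2 (kap b0 e n d (encode a))) (h3.and (h4.and h2.2))
  refine ⟨h5.of_iff fun i a => ?_, h6.of_iff fun i a => ?_⟩
  · rw [hΦ]; simp
  · refine (not_congr (hΦ a)).trans ?_; simp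

theorem S1.jumpIter_tower (d m : ℕ) : S1 (fun _ : Unit => AA m) (fun _ => tower d m)
    fun _ (q : ℕ × ℕ) => jumpIter (tower d 0) m q.1 = q.2 := by
  induction m with
  | zero => exact S1.query_right (by fun_prop) (by fun_prop)
  | succ m ih =>
    have h1 : S1 (fun _ : Unit => AA m) (fun _ => jumpIter (tower d 0) m)
        fun _ (q : ℕ × ℕ) => q.2 ∈ Harrington.evalo (jumpIter (tower d 0) m) (OCode.ofNat q.1) q.1 :=
      S1.evalo (by fun_prop) (by fun_prop) (by fun_prop)
    have h2 := S1.ex (Φ := fun (_ : Unit) (e y : ℕ) =>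
      y ∈ Harrington.evalo (jumpIter (tower d 0) m) (OCode.ofNat e) e) h1
    have h3 := (h2.change (S1.query_left (by fun_prop) (by fun_prop)) ih).tower_succ
    have h4 : D1 (fun _ : Unit => AA (m + 1)) (fun _ => tower d (m + 1)) fun _ (q : ℕ × ℕ) =>
        ∃ y, y ∈ Harrington.evalo (jumpIter (tower d 0) m) (OCode.ofNat q.1) q.1 :=
      h3.comp (by fun_prop)
    refine (((S1.prim (p := fun q : ℕ × ℕ => q.2 = 1) (by fun_prop)).and h4.1).or
      ((S1.prim (p := fun q : ℕ × ℕ => q.2 = 0) (by fun_prop)).and h4.2)).of_iff fun i q => ?_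
    rw [jumpIter, Harrington.jump]
    simp only [Part.dom_iff_mem]
    split_ifs with h
    · simp [h, eq_comm]
    · simp [h, eq_comm]

theorem S1.AA_eq {l m : ℕ} (h : l ≤ m) :
    S1 (fun _ : Unit => AA m) P fun _ (q : ℕ × ℕ) => AA l q.1 = q.2 := by
  induction m, h using Nat.le_induction generalizing P with
  | base => exact S1.query_left (by fun_prop) (by fun_prop)
  | succ m _ ih => exact (S1.jump (O := fun _ : Unit => AA m) (ih (P := fun _ => zeroF))).1

theorem exists_index_of_arithIn {D d : ℕ} (h : ArithIn (tower D 0) (tower d 0)) :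
    ∃ m e, ∀ π : Str, W (AA m) (tower d m) e (encode π) ↔ Seg π (tower D m) := by
  obtain ⟨m, c, hc⟩ := h
  obtain ⟨e, rfl⟩ := exists_ofNat_eq c
  have h0 : S1 (fun _ : Unit => AA m) (fun _ => tower d m)
      fun _ (q : ℕ × ℕ) => tower D 0 q.1 = q.2 := by
    have h1 : S1 (fun _ : Unit => AA m) (fun _ => jumpIter (tower d 0) m)
        fun _ (q : ℕ × ℕ) => q.2 ∈ Harrington.evalo (jumpIter (tower d 0) m) (OCode.ofNat e) q.1 :=
      S1.evalo (by fun_prop) (by fun_prop) (by fun_prop)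
    refine (h1.change (S1.query_left (by fun_prop) (by fun_prop))
      (S1.jumpIter_tower d m)).of_iff fun i q => ?_
    rw [hc, Part.mem_some_iff, eq_comm]
  have hk : ∀ k ≤ m, S1 (fun _ : Unit => AA m) (fun _ => tower d m)
      fun _ (π : Str) => Seg π (tower D k) := by
    intro k
    induction k with
    | zero =>
      intro _
      have h1 : S1 (fun _ : Unit => AA m) (fun _ => tower D 0)
        fun _ (π : Str) => Seg π (tower D 0) := (D1.seg (by fun_prop)).1
      exact h1.change (S1.query_left (by fun_prop) (by fun_prop)) h0
    | succ k ih =>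
      intro hkm
      have h1 : S1 (fun _ : Unit => AA m) (fun _ => tower d m)
          fun _ (q : Str × Str × Str × Str) => Seg q.2.1 (tower D k) :=
        (ih (by omega)).comp (by fun_prop)
      have h2 : S1 (fun _ : Unit => AA (k + 1)) (fun _ => tower d m)
          fun _ (q : Str × Str × Str × Str) => F (AA k) q.2.2.1 = q.2.2.2 :=
        S1.F_eq (ι := Unit) (O := fun _ => AA k) (by fun_prop) (by fun_prop)
      have h3 : S1 (fun _ : Unit => AA m) (fun _ => tower d m)
          fun _ (q : Str × Str × Str × Str) => F (AA k) q.2.2.1 = q.2.2.2 :=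
        h2.change (S1.AA_eq hkm) (S1.query_right (by fun_prop) (by fun_prop))
      have h4 : S1 (fun _ : Unit => AA m) (fun _ => tower d m)
          fun _ (q : Str × Str × Str × Str) => q.2.2.2 <+: evens q.2.1 ∧ q.1 <+: vals q.2.2.1 :=
        S1.prim (by fun_prop)
      have h5 := S1.ex (Φ := fun (_ : Unit) (π : Str) (q : Str × Str × Str) =>
        Seg q.1 (tower D k) ∧ F (AA k) q.2.1 = q.2.2 ∧ q.2.2 <+: evens q.1 ∧ π <+: vals q.2.1)
        (h1.and (h3.and h4))
      refine h5.of_iff fun i π => ?_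
      rw [seg_tower_succ]
      simp
  obtain ⟨e, he⟩ := (hk m le_rfl).index
  exact ⟨m, e, fun π => he () π⟩

theorem not_arithIn_tower {D d : ℕ} (hD : D < 2) (hd : d < 2) (hne : D ≠ d) :
    ¬ ArithIn (tower D 0) (tower d 0) := by
  intro h
  obtain ⟨m, e, he⟩ := exists_index_of_arithIn h
  obtain ⟨n, hn⟩ : ∃ n, n = 2 * Nat.pair m e + D := ⟨_, rfl⟩
  have hmn : m ≤ n := by have := Nat.left_le_pair m e; omega
  obtain ⟨l, rfl⟩ := Nat.exists_eq_add_of_le hmn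
  have hpar : (m + l + 1) % 2 = d := by omega
  have hhalf : (m + l) / 2 = Nat.pair m e := by omega
  set n := m + l with hn'
  have hκ : kz b0 eQ n = kap b0 eQ n d (encode (b0, l, e, n, d, ([] : Str))) := by
    rw [kz, kq, hhalf, hpar, Nat.unpair_pair]
    simp only [hn', Nat.add_sub_cancel_left]
  have hW (M : ℕ) : W (AA n) (tower d n) eQ
      (Nat.pair (encode (b0, l, e, n, d, ([] : Str))) M) ↔ tower D n 0 = M := by
    refine (W_eQ_tower_iff he l [] M).trans (seg_concat.trans ?_)
    simp [Seg, initSeg, hn']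
  have hz : zf (AA n) b0 eQ n d = Nat.pair (kz b0 eQ n) 0 := by rw [zf, if_pos hpar.symm]
  have hZ : initSeg (Zof (zf (AA n) b0 eQ n d) (tower d (n + 1))) 1 = [Nat.pair (kz b0 eQ n) 0] := by
    rw [← hz]; rfl
  have hf : ∃ M, forced (AA n) (F (AA n) [Nat.pair (kz b0 eQ n) 0])
      (kz b0 eQ n).unpair.1 (Nat.pair (kz b0 eQ n).unpair.2 M) := by
    have h1 : fact (AA n) (tgen d n) (kz b0 eQ n) := by
      rw [hκ, fact_tgen_kap_iff]; exact ⟨_, (hW _).2 rfl⟩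
    rw [tgen, gen, fact_Fpath_iff (k := 0) (by simp [Zof, hz]), zero_add, hZ] at h1
    exact h1
  have hM : tower D n 0 = Nat.find hf := by
    have h1 := Nat.find_spec hf
    generalize Nat.find hf = M at h1 ⊢
    rw [← hZ, F_eq_initSeg] at h1
    have h2 : W (AA n) (tgen d n) (kz b0 eQ n).unpair.1
        (Nat.pair (kz b0 eQ n).unpair.2 M) := W_iff_forced.2 ⟨_, h1⟩
    rw [hκ, W_kap (good_tgen d n), ← tower_eq_mk] at h2
    exact (hW _).1 h2
  have hD0 : tower D n 0 = Nat.pair 0 (Nat.find hf + 1) := by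
    have h1 : tower D n 0 = tgen D n 0 := congrFun (evenF_tower D n) 0
    rw [h1, tgen, gen, Fpath_zero]
    change zf (AA n) b0 eQ n D = _
    rw [zf, if_neg (by omega), forcedWit, dif_pos hf]
  have := Nat.right_le_pair 0 (Nat.find hf + 1)
  omega

end Incomparability

end HarringtonConstruction

/-- **Harrington.**  There exist arithmetically incomparable `Π⁰₁` singletons:
points `X, Y` of Baire space such that `{X}` and `{Y}` are `Π⁰₁` sets, `X` is not
arithmetical relative to `Y`, and `Y` is not arithmetical relative to `X`. -/
theorem arithmetically_incomparable_pi01_singletons :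
    ∃ X Y : ℕ → ℕ, IsPi01 {X} ∧ IsPi01 {Y} ∧ ¬ ArithIn X Y ∧ ¬ ArithIn Y X := by
  exact ⟨tower 0 0, tower 1 0, isPi01_tower 0, isPi01_tower 1,
    not_arithIn_tower (by omega) (by omega) (by omega),
    not_arithIn_tower (by omega) (by omega) (by omega)⟩

end Harrington
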